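/- Let p ∈ (1,∞), n ≥ 2, k ∈ {1,…,n−1}, and −∞ < a_i < b_i < ∞ for i = 1,…,n−k; set D = ℝ^k × ∏_{i=1}^{n−k}(a_i,b_i) ⊆ ℝⁿ, and let I denote the canonical embedding W_0^{1,p}(D) ↪ L^p(D). Then for every m ∈ ℕ, the approximation, Bernstein, Gelfand, Kolmogorov, isomorphism and Mityagin numbers of I, as well as the entropy numbers of I, all equal ‖I‖ = (1 + π_p^p (p−1) Σ_{i=1}^{n−k} (b_i−a_i)^{−p})^{−1/p}. -/

import Mathlib

open MeasureTheory ENNReal Set Filter Topology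

noncomputable section

/-- The `i`-th partial derivative of `u : ℝⁿ → ℝ`. -/
def pder {n : ℕ} (i : Fin n) (u : (Fin n → ℝ) → ℝ) (x : Fin n → ℝ) : ℝ :=
  fderiv ℝ u x (Pi.single i 1)

/-- `u` is a smooth function compactly supported in the open set `D`. -/
def IsTestFun {n : ℕ} (D : Set (Fin n → ℝ)) (u : (Fin n → ℝ) → ℝ) : Prop :=
  ContDiff ℝ (⊤ : ℕ∞) u ∧ HasCompactSupport u ∧ tsupport u ⊆ D

/-- The strip-like domain `ℝᵏ × ∏_{i ≥ k} (aᵢ, bᵢ)`, realized as a subset of `ℝⁿ`: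
the coordinates `i < k` are free, the coordinates `i ≥ k` are constrained to `(aᵢ, bᵢ)`. -/
def stripDomain (n k : ℕ) (a b : Fin n → ℝ) : Set (Fin n → ℝ) :=
  {x | ∀ i : Fin n, k ≤ (i : ℕ) → x i ∈ Set.Ioo (a i) (b i)}

/-- The ambient space `V = L^p(ℝⁿ; ℓ^p(ℝ^{n+1}))`, in which the Sobolev space `W^{1,p}_0`
is realized as the closure of the set of "jets" `(u, ∇u)` of test functions. -/
abbrev Vsp (n : ℕ) (p : ℝ≥0∞) [Fact (1 ≤ p)] :=
  Lp (PiLp p (fun _ : Fin (n + 1) => ℝ)) p (volume : Measure (Fin n → ℝ))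

/-- The "jet" `(u, ∂₁u, …, ∂ₙu)` of a function, valued in `ℓ^p(ℝ^{n+1})`. -/
def jet {n : ℕ} (p : ℝ≥0∞) (u : (Fin n → ℝ) → ℝ) (x : Fin n → ℝ) :
    PiLp p (fun _ : Fin (n + 1) => ℝ) :=
  (WithLp.equiv p (∀ _ : Fin (n + 1), ℝ)).symm (Fin.cons (u x) (fun i => pder i u x))

/-- `W^{1,p}_0(D)` realized as a closed subspace of `V`:
the closure of the subspace of jets of test functions supported in `D`.
The (subspace) norm of the jet of `u` is exactly
`(‖u‖_p^p + ‖ |∇u|_{ℓ^p} ‖_p^p)^{1/p}`, i.e., the `W^{1,p}`-norm of `u`. -/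
def W0sub {n : ℕ} (p : ℝ≥0∞) [Fact (1 ≤ p)] (D : Set (Fin n → ℝ)) : Submodule ℝ (Vsp n p) :=
  (Submodule.span ℝ {f : Vsp n p | ∃ u : (Fin n → ℝ) → ℝ, IsTestFun D u ∧
    (f : (Fin n → ℝ) → PiLp p (fun _ : Fin (n + 1) => ℝ)) =ᵐ[volume] jet p u}).topologicalClosure

instance W0sub.completeSpace {n : ℕ} (p : ℝ≥0∞) [Fact (1 ≤ p)] (D : Set (Fin n → ℝ)) :
    CompleteSpace (W0sub (n := n) p D) :=
  (Submodule.isClosed_topologicalClosure _).completeSpace_coe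

/-- Projection of a jet onto its zeroth (function) component. -/
def proj0 (n : ℕ) (p : ℝ≥0∞) [Fact (1 ≤ p)] : PiLp p (fun _ : Fin (n + 1) => ℝ) →L[ℝ] ℝ :=
  (ContinuousLinearMap.proj (0 : Fin (n + 1))).comp
    (PiLp.continuousLinearEquiv p ℝ (fun _ : Fin (n + 1) => ℝ)).toContinuousLinearMap

/-- Projection of a jet onto its gradient components, valued in `ℓ^p(ℝⁿ)`. -/
def projGrad (n : ℕ) (p : ℝ≥0∞) [Fact (1 ≤ p)] :
    PiLp p (fun _ : Fin (n + 1) => ℝ) →L[ℝ] PiLp p (fun _ : Fin n => ℝ) :=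
  ((PiLp.continuousLinearEquiv p ℝ (fun _ : Fin n => ℝ)).symm.toContinuousLinearMap).comp
    ((ContinuousLinearMap.pi fun i : Fin n => ContinuousLinearMap.proj (R := ℝ) i.succ).comp
      (PiLp.continuousLinearEquiv p ℝ (fun _ : Fin (n + 1) => ℝ)).toContinuousLinearMap)

/-- The canonical Sobolev embedding `I : W^{1,p}_0(D) → L^p(D)` (as a map into `L^p(ℝⁿ)`;
all functions in `W^{1,p}_0(D)` vanish a.e. outside `D`). -/
def SobolevEmb {n : ℕ} (p : ℝ≥0∞) [Fact (1 ≤ p)] (D : Set (Fin n → ℝ)) :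
    W0sub (n := n) p D →L[ℝ] Lp ℝ p (volume : Measure (Fin n → ℝ)) :=
  ((proj0 n p).compLpL p volume).comp (W0sub p D).subtypeL

/-- The gradient map `W^{1,p}_0(D) → L^p(D; ℓ^p(ℝⁿ))`, `u ↦ ∇u`. -/
def SobolevGrad {n : ℕ} (p : ℝ≥0∞) [Fact (1 ≤ p)] (D : Set (Fin n → ℝ)) :
    W0sub (n := n) p D →L[ℝ] Lp (PiLp p (fun _ : Fin n => ℝ)) p (volume : Measure (Fin n → ℝ)) :=
  ((projGrad n p).compLpL p volume).comp (W0sub p D).subtypeL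

/-- `π_p = 2 ∫₀¹ (1 - sᵖ)^{-1/p} ds`. -/
def piP (p : ℝ) : ℝ := 2 * ∫ s in (0 : ℝ)..1, (1 - s ^ p) ^ (-1 / p)

/-- The inverse of `t ↦ ∫₀ᵗ (1 - sᵖ)^{-1/p} ds` on `[0,1]`; this is `sin_p` on `[0, π_p/2]`. -/
def sinpHalf (p : ℝ) : ℝ → ℝ :=
  Function.invFunOn (fun t : ℝ => ∫ s in (0 : ℝ)..t, (1 - s ^ p) ^ (-1 / p)) (Set.Icc 0 1)

/-- `sin_p` on `[0, π_p]`, by reflection around `π_p/2`. -/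
def sinpBase (p t : ℝ) : ℝ :=
  if t ≤ piP p / 2 then sinpHalf p t else sinpHalf p (piP p - t)

/-- `sin_p` on `[-π_p, π_p]`, by odd reflection. -/
def sinpSym (p t : ℝ) : ℝ := if 0 ≤ t then sinpBase p t else -sinpBase p (-t)

/-- The generalized sine function `sin_p`, extended `2π_p`-periodically to all of `ℝ`. -/
def sinp (p t : ℝ) : ℝ :=
  sinpSym p (t - 2 * piP p * ⌊(t + piP p) / (2 * piP p)⌋)

/-- The generalized cosine function `cos_p = (sin_p)'`. -/
def cosp (p : ℝ) : ℝ → ℝ := deriv (sinp p)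

/-- The `m`-th entropy number of a bounded linear operator: the infimum of all `ε > 0` such
that the image of the closed unit ball can be covered by `2^{m-1}` balls of radius `ε`. -/
def entropyNumber {X Y : Type*} [NormedAddCommGroup X] [NormedSpace ℝ X]
    [NormedAddCommGroup Y] [NormedSpace ℝ Y] (m : ℕ) (T : X →L[ℝ] Y) : ℝ :=
  sInf {ε : ℝ | 0 < ε ∧ ∃ c : Fin (2 ^ (m - 1)) → Y,
    ∀ x : X, ‖x‖ ≤ 1 → ∃ j, ‖T x - c j‖ ≤ ε}

end

noncomputable section SNumbers

variable {X Y : Type} [NormedAddCommGroup X] [NormedSpace ℝ X]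
  [NormedAddCommGroup Y] [NormedSpace ℝ Y]

/-- The `m`-th approximation number: `a_m(T) = inf {‖T - F‖ : rank F < m}`. -/
def approxNumber (m : ℕ) (T : X →L[ℝ] Y) : ℝ :=
  sInf {r : ℝ | ∃ F : X →L[ℝ] Y,
    Module.rank ℝ (LinearMap.range (F : X →ₗ[ℝ] Y)) < (m : Cardinal) ∧ r = ‖T - F‖}

/-- The `m`-th Gelfand number: `c_m(T) = inf {‖T ∘ J_M‖ : M ⊆ X subspace, codim M < m}`. -/
def gelfandNumber (m : ℕ) (T : X →L[ℝ] Y) : ℝ :=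
  sInf {r : ℝ | ∃ M : Submodule ℝ X,
    Module.rank ℝ (X ⧸ M) < (m : Cardinal) ∧ r = ‖T.comp M.subtypeL‖}

/-- The `m`-th Kolmogorov number:
`d_m(T) = inf {sup_{‖x‖≤1} dist(Tx, N) : N ⊆ Y subspace, dim N < m}`. -/
def kolmogorovNumber (m : ℕ) (T : X →L[ℝ] Y) : ℝ :=
  sInf {r : ℝ | 0 ≤ r ∧ ∃ N : Submodule ℝ Y, Module.rank ℝ N < (m : Cardinal) ∧
    ∀ x : X, ‖x‖ ≤ 1 → Metric.infDist (T x) ↑N ≤ r}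

/-- The `m`-th Bernstein number:
`b_m(T) = sup {inf_{x ∈ M, x ≠ 0} ‖Tx‖/‖x‖ : M ⊆ X subspace, dim M ≥ m}`. -/
def bernsteinNumber (m : ℕ) (T : X →L[ℝ] Y) : ℝ :=
  sSup {r : ℝ | 0 ≤ r ∧ ∃ M : Submodule ℝ X, (m : Cardinal) ≤ Module.rank ℝ M ∧
    ∀ x ∈ M, r * ‖x‖ ≤ ‖T x‖}

/-- The `m`-th Mityagin number:
`m_m(T) = sup {ρ ≥ 0 : ρ B_{Y/N} ⊆ Q_N(T(B_X)) for some closed N ⊆ Y with dim Y/N ≥ m}`. -/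
def mityaginNumber (m : ℕ) (T : X →L[ℝ] Y) : ℝ :=
  sSup {r : ℝ | 0 ≤ r ∧ ∃ N : Submodule ℝ Y, IsClosed (N : Set Y) ∧
    (m : Cardinal) ≤ Module.rank ℝ (Y ⧸ N) ∧
    ∀ w : Y ⧸ N, ‖w‖ ≤ r → ∃ x : X, ‖x‖ ≤ 1 ∧ Submodule.Quotient.mk (T x) = w}

/-- The `m`-th isomorphism number:
`i_m(T) = sup ‖A‖⁻¹‖B‖⁻¹` over Banach `G` with `dim G ≥ m` and `A : Y → G`, `B : G → X`
with `A T B = id_G`. -/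
def isoNumber (m : ℕ) (T : X →L[ℝ] Y) : ℝ :=
  sSup {r : ℝ | ∃ (G : Type) (_i : NormedAddCommGroup G), letI := _i;
    ∃ (_j : NormedSpace ℝ G), letI := _j;
    ∃ (_c : CompleteSpace G), (m : Cardinal) ≤ Module.rank ℝ G ∧
      ∃ (A : Y →L[ℝ] G) (B : G →L[ℝ] X),
        A.comp (T.comp B) = ContinuousLinearMap.id ℝ G ∧ r = ‖A‖⁻¹ * ‖B‖⁻¹}

end SNumbers

section AbstractSNumbers

variable {X Y : Type} [NormedAddCommGroup X] [NormedSpace ℝ X]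
  [NormedAddCommGroup Y] [NormedSpace ℝ Y]

/-- `T` factors the identity of `ℓ^q_N` through an isometric copy: `A T B = id` with `‖B‖ ≤ 1`
and `‖A‖ ≤ 1 / r`. -/
def FactorsIdentity (q : ℝ≥0∞) [Fact (1 ≤ q)] (T : X →L[ℝ] Y) (r : ℝ) (N : ℕ) : Prop :=
  ∃ (A : Y →L[ℝ] PiLp q (fun _ : Fin N => ℝ)) (B : PiLp q (fun _ : Fin N => ℝ) →L[ℝ] X),
    (∀ g, A (T (B g)) = g) ∧ (∀ y, r * ‖A y‖ ≤ ‖y‖) ∧ ∀ g, ‖B g‖ ≤ ‖g‖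

variable {q : ℝ≥0∞} [Fact (1 ≤ q)] {T : X →L[ℝ] Y} {r : ℝ} {m : ℕ}

theorem rank_piLp (q : ℝ≥0∞) [Fact (1 ≤ q)] (N : ℕ) :
    Module.rank ℝ (PiLp q (fun _ : Fin N => ℝ)) = (N : Cardinal) := by
  rw [(WithLp.linearEquiv q ℝ (Fin N → ℝ)).rank_eq, rank_fin_fun]

theorem exists_ne_zero_of_rank_lt {Z : Type} [AddCommGroup Z] [Module ℝ Z]
    (f : PiLp q (fun _ : Fin m => ℝ) →ₗ[ℝ] Z)
    (h : Module.rank ℝ (LinearMap.range f) < (m : Cardinal)) : ∃ g, g ≠ 0 ∧ f g = 0 := by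
  by_contra! hcon
  have hinj : LinearMap.ker f = ⊥ := by
    rw [LinearMap.ker_eq_bot']
    intro g hg
    by_contra hne
    exact hcon g hne hg
  have := LinearMap.rank_range_add_rank_ker f
  rw [hinj, rank_bot, add_zero, rank_piLp] at this
  exact absurd this h.ne

theorem FactorsIdentity.le_norm_of_rank_lt (h : FactorsIdentity q T r m) {Z : Type}
    [AddCommGroup Z] [Module ℝ Z] (f : X →ₗ[ℝ] Z)
    (hf : Module.rank ℝ (LinearMap.range f) < (m : Cardinal)) :
    ∃ x, x ≠ 0 ∧ f x = 0 ∧ 0 < ‖x‖ ∧ (0 ≤ r → r * ‖x‖ ≤ ‖T x‖) := by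
  obtain ⟨A, B, hAB, hA, hB⟩ := h
  obtain ⟨g, hg0, hg⟩ := exists_ne_zero_of_rank_lt (f ∘ₗ B.toLinearMap) (by
    refine lt_of_le_of_lt ?_ hf
    exact Submodule.rank_mono (LinearMap.range_comp_le_range _ _))
  have hne : B g ≠ 0 := by
    intro h0
    apply hg0
    rw [← hAB g, h0]; simp
  refine ⟨B g, hne, hg, norm_pos_iff.2 hne, fun hr => ?_⟩
  calc r * ‖B g‖ ≤ r * ‖g‖ := by gcongr; exact hB g
    _ = r * ‖A (T (B g))‖ := by rw [hAB]
    _ ≤ _ := hA _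

theorem FactorsIdentity.le_approxNumber (h : FactorsIdentity q T r m) (hr : 0 < r)
    (hm : 1 ≤ m) : r ≤ approxNumber m T := by
  refine le_csInf ⟨‖T - 0‖, 0, ?_, rfl⟩ ?_
  · have : LinearMap.range ((0 : X →L[ℝ] Y) : X →ₗ[ℝ] Y) = ⊥ := LinearMap.range_zero
    rw [this, rank_bot]
    exact_mod_cast hm
  · rintro _ ⟨F, hF, rfl⟩
    obtain ⟨x, -, hFx, hx, hle⟩ := h.le_norm_of_rank_lt (F : X →ₗ[ℝ] Y) hF
    have h1 := (T - F).le_opNorm x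
    have h2 : F x = 0 := hFx
    rw [sub_apply, h2, sub_zero] at h1
    exact le_of_mul_le_mul_right ((hle hr.le).trans h1) hx

theorem FactorsIdentity.le_gelfandNumber (h : FactorsIdentity q T r m) (hr : 0 < r)
    (hm : 1 ≤ m) : r ≤ gelfandNumber m T := by
  refine le_csInf ⟨_, ⊤, ?_, rfl⟩ ?_
  · rw [rank_subsingleton']
    exact_mod_cast hm
  · rintro _ ⟨M, hM, rfl⟩
    obtain ⟨x, -, hFx, hx, hle⟩ := h.le_norm_of_rank_lt M.mkQ (by
      rwa [Submodule.range_mkQ, rank_top])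
    have hxM : x ∈ M := by simpa using hFx
    have h1 := (T.comp M.subtypeL).le_opNorm ⟨x, hxM⟩
    exact le_of_mul_le_mul_right ((hle hr.le).trans h1) hx

theorem FactorsIdentity.le_kolmogorovNumber (h : FactorsIdentity q T r m) (hr : 0 < r)
    (hm : 1 ≤ m) : r ≤ kolmogorovNumber m T := by
  obtain ⟨A, B, hAB, hA, hB⟩ := h
  refine le_csInf ⟨‖T‖, norm_nonneg _, ⊥, ?_, ?_⟩ ?_
  · rw [rank_bot]
    exact_mod_cast hm
  · intro x hx
    simp only [Submodule.bot_coe, Metric.infDist_singleton, dist_zero_right]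
    exact T.unit_le_opNorm x hx
  · rintro ρ ⟨hρ, N, hN, hdist⟩
    have hlt : Module.rank ℝ (N.map A.toLinearMap) < (m : Cardinal) :=
      lt_of_le_of_lt (by simpa using lift_rank_map_le A.toLinearMap N) hN
    have hne : ∃ g, g ∉ N.map A.toLinearMap := by
      by_contra! hcon
      rw [(Submodule.eq_top_iff').2 hcon, rank_top, rank_piLp] at hlt
      exact lt_irrefl _ hlt
    refine le_of_forall_lt fun s hs => ?_
    have hsr : s / r < 1 := by rwa [div_lt_one hr]
    obtain ⟨θ, hθ1, hθ2⟩ := exists_between hsr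
    obtain ⟨g, hgN, hg⟩ := riesz_lemma (Submodule.closed_of_finiteDimensional _) hne hθ2
    have hg0 : 0 < ‖g‖ := norm_pos_iff.2 fun h0 => hgN (h0 ▸ Submodule.zero_mem _)
    have key : r * θ ≤ ρ := by
      refine le_trans ?_ (hdist (‖g‖⁻¹ • B g) ?_)
      · rw [Metric.le_infDist ⟨0, N.zero_mem⟩]
        intro y hy
        rw [dist_eq_norm]
        refine le_trans ?_ (hA _)
        gcongr
        have h1 := hg (A (‖g‖ • y)) (Submodule.mem_map_of_mem (N.smul_mem _ hy))
        have h2 : A (T (‖g‖⁻¹ • B g) - y) = ‖g‖⁻¹ • (g - A (‖g‖ • y)) := by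
          simp [hAB, smul_sub, smul_smul, hg0.ne']
        rw [h2, norm_smul, norm_inv, norm_norm, le_inv_mul_iff₀ hg0]
        linarith
      · rw [norm_smul, norm_inv, norm_norm, inv_mul_le_iff₀ hg0]
        simpa using hB g
    have : s < r * θ := by rwa [div_lt_iff₀' hr] at hθ1
    linarith

theorem FactorsIdentity.le_bernsteinNumber (h : FactorsIdentity q T r m) (hr : 0 < r)
    (hm : 1 ≤ m) : r ≤ bernsteinNumber m T ∧ bernsteinNumber m T ≤ ‖T‖ := by
  have hb : ∀ s ∈ {r : ℝ | 0 ≤ r ∧ ∃ M : Submodule ℝ X, (m : Cardinal) ≤ Module.rank ℝ M ∧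
      ∀ x ∈ M, r * ‖x‖ ≤ ‖T x‖}, s ≤ ‖T‖ := by
    rintro s ⟨hs, M, hM, hle⟩
    have : (0 : Cardinal) < Module.rank ℝ M := lt_of_lt_of_le (by exact_mod_cast hm) hM
    have := rank_pos_iff_exists_ne_zero.1 this
    obtain ⟨⟨x, hxM⟩, hx⟩ := this
    have hx0 : 0 < ‖x‖ := norm_pos_iff.2 fun h0 => hx (by ext; simpa using h0)
    exact le_of_mul_le_mul_right ((hle x hxM).trans (T.le_opNorm x)) hx0
  obtain ⟨A, B, hAB, hA, hB⟩ := h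
  have hmem : r ∈ {r : ℝ | 0 ≤ r ∧ ∃ M : Submodule ℝ X, (m : Cardinal) ≤ Module.rank ℝ M ∧
      ∀ x ∈ M, r * ‖x‖ ≤ ‖T x‖} := by
    refine ⟨hr.le, LinearMap.range B.toLinearMap, ?_, ?_⟩
    · have hinj : Function.Injective B.toLinearMap := by
        intro g g' hgg
        have h' : B g = B g' := hgg
        rw [← hAB g, h', hAB]
      rw [← (LinearEquiv.ofInjective _ hinj).rank_eq, rank_piLp]
    · rintro _ ⟨g, rfl⟩
      calc r * ‖B g‖ ≤ r * ‖g‖ := by gcongr; exact hB g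
        _ = r * ‖A (T (B g))‖ := by rw [hAB]
        _ ≤ _ := hA _
  exact ⟨le_csSup ⟨_, hb⟩ hmem, csSup_le ⟨_, hmem⟩ hb⟩

theorem FactorsIdentity.le_isoNumber (h : FactorsIdentity q T r m) (hr : 0 < r)
    (hm : 1 ≤ m) : r ≤ isoNumber m T ∧ isoNumber m T ≤ ‖T‖ := by
  have hb : ∀ s ∈ {r : ℝ | ∃ (G : Type) (_i : NormedAddCommGroup G), letI := _i;
      ∃ (_j : NormedSpace ℝ G), letI := _j;
      ∃ (_c : CompleteSpace G), (m : Cardinal) ≤ Module.rank ℝ G ∧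
        ∃ (A : Y →L[ℝ] G) (B : G →L[ℝ] X),
          A.comp (T.comp B) = ContinuousLinearMap.id ℝ G ∧ r = ‖A‖⁻¹ * ‖B‖⁻¹}, s ≤ ‖T‖ := by
    rintro s ⟨G, i, j, c, hG, A, B, hAB, rfl⟩
    have : (0 : Cardinal) < Module.rank ℝ G := lt_of_lt_of_le (by exact_mod_cast hm) hG
    have : Nontrivial G := rank_pos_iff_nontrivial.1 this
    have h1 : 1 ≤ ‖A‖ * (‖T‖ * ‖B‖) := by
      have := ContinuousLinearMap.norm_id (𝕜 := ℝ) (E := G)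
      rw [← this, ← hAB]
      exact (A.opNorm_comp_le _).trans (by gcongr; exact T.opNorm_comp_le _)
    have hA : 0 < ‖A‖ := by
      refine (norm_nonneg _).lt_of_ne fun h0 => ?_
      rw [← h0] at h1; norm_num at h1
    have hB : 0 < ‖B‖ := by
      refine (norm_nonneg _).lt_of_ne fun h0 => ?_
      rw [← h0] at h1; norm_num at h1
    rw [← mul_inv, inv_le_iff_one_le_mul₀ (by positivity)]
    linarith
  obtain ⟨A, B, hAB, hA, hB⟩ := h
  have : Nontrivial (PiLp q (fun _ : Fin m => ℝ)) := by
    rw [← rank_pos_iff_nontrivial (R := ℝ), rank_piLp]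
    exact_mod_cast hm
  have hcomp : A.comp (T.comp B) = ContinuousLinearMap.id ℝ _ := by
    ext1 g; exact hAB g
  have hle : r ≤ ‖A‖⁻¹ * ‖B‖⁻¹ := by
    obtain ⟨g, hg⟩ := exists_ne (0 : PiLp q (fun _ : Fin m => ℝ))
    have hA0 : 0 < ‖A‖ := norm_pos_iff.2 fun h0 => hg (by rw [← hAB g, h0]; simp)
    have hB0 : 0 < ‖B‖ := norm_pos_iff.2 fun h0 => hg (by rw [← hAB g, h0]; simp)
    have hA1 : ‖A‖ ≤ r⁻¹ := A.opNorm_le_bound (by positivity) fun y => by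
      rw [le_inv_mul_iff₀ hr]; exact hA y
    have hB1 : ‖B‖ ≤ 1 := B.opNorm_le_bound zero_le_one fun y => by simpa using hB y
    have h1 : r ≤ ‖A‖⁻¹ := (le_inv_comm₀ hA0 hr).1 hA1
    have h2 : 1 ≤ ‖B‖⁻¹ := (one_le_inv₀ hB0).2 hB1
    calc r = r * 1 := (mul_one r).symm
      _ ≤ _ := by gcongr
  have hmem : ‖A‖⁻¹ * ‖B‖⁻¹ ∈ {r : ℝ | ∃ (G : Type) (_i : NormedAddCommGroup G), letI := _i;
      ∃ (_j : NormedSpace ℝ G), letI := _j;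
      ∃ (_c : CompleteSpace G), (m : Cardinal) ≤ Module.rank ℝ G ∧
        ∃ (A : Y →L[ℝ] G) (B : G →L[ℝ] X),
          A.comp (T.comp B) = ContinuousLinearMap.id ℝ G ∧ r = ‖A‖⁻¹ * ‖B‖⁻¹} :=
    ⟨PiLp q (fun _ : Fin m => ℝ), inferInstance, inferInstance, inferInstance,
      (rank_piLp q m).ge, A, B, hcomp, rfl⟩
  exact ⟨hle.trans (le_csSup ⟨_, hb⟩ hmem), csSup_le ⟨_, hmem⟩ hb⟩

theorem FactorsIdentity.le_mityaginNumber (h : FactorsIdentity q T r m) (hr : 0 < r)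
    (hm : 1 ≤ m) : r ≤ mityaginNumber m T ∧ mityaginNumber m T ≤ ‖T‖ := by
  have hb : ∀ s ∈ {r : ℝ | 0 ≤ r ∧ ∃ N : Submodule ℝ Y, IsClosed (N : Set Y) ∧
      (m : Cardinal) ≤ Module.rank ℝ (Y ⧸ N) ∧
      ∀ w : Y ⧸ N, ‖w‖ ≤ r → ∃ x : X, ‖x‖ ≤ 1 ∧ Submodule.Quotient.mk (T x) = w},
      s ≤ ‖T‖ := by
    rintro s ⟨hs, N, hN, hdim, hcov⟩
    have : (0 : Cardinal) < Module.rank ℝ (Y ⧸ N) := lt_of_lt_of_le (by exact_mod_cast hm) hdim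
    have hnt : Nontrivial (Y ⧸ N) := rank_pos_iff_nontrivial.1 this
    have : IsClosed (N : Set Y) := hN
    obtain ⟨w, hw⟩ := exists_ne (0 : Y ⧸ N)
    have hw0 : 0 < ‖w‖ := norm_pos_iff.2 hw
    have hnorm : ‖(s * ‖w‖⁻¹) • w‖ = s := by
      rw [norm_smul, norm_mul, norm_inv, norm_norm, Real.norm_of_nonneg hs]
      field_simp
    obtain ⟨x, hx, hxw⟩ := hcov ((s * ‖w‖⁻¹) • w) hnorm.le
    rw [← hnorm, ← hxw]
    exact (Submodule.Quotient.norm_mk_le N (T x)).trans (T.unit_le_opNorm x hx)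
  obtain ⟨A, B, hAB, hA, hB⟩ := h
  have hmem : r ∈ {r : ℝ | 0 ≤ r ∧ ∃ N : Submodule ℝ Y, IsClosed (N : Set Y) ∧
      (m : Cardinal) ≤ Module.rank ℝ (Y ⧸ N) ∧
      ∀ w : Y ⧸ N, ‖w‖ ≤ r → ∃ x : X, ‖x‖ ≤ 1 ∧ Submodule.Quotient.mk (T x) = w} := by
    refine ⟨hr.le, LinearMap.ker A.toLinearMap, A.isClosed_ker, ?_, ?_⟩
    · have hsurj : Function.Surjective A.toLinearMap :=
        fun g => ⟨T (B g), hAB g⟩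
      rw [(A.toLinearMap.quotKerEquivOfSurjective hsurj).rank_eq,
        rank_piLp]
    · intro w hw
      obtain ⟨y, rfl⟩ := Submodule.Quotient.mk_surjective _ w
      refine ⟨B (A y), (hB _).trans ?_, ?_⟩
      · refine le_of_mul_le_mul_left ?_ hr
        rw [mul_one]
        refine le_trans ?_ hw
        have hn : ‖(Submodule.Quotient.mk y : Y ⧸ LinearMap.ker A.toLinearMap)‖ =
            Metric.infDist y (LinearMap.ker A.toLinearMap) := QuotientAddGroup.norm_mk y
        rw [hn, Metric.le_infDist ⟨0, Submodule.zero_mem _⟩]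
        intro z hz
        have hz' : A z = 0 := hz
        have := hA (y - z)
        rw [map_sub, hz', sub_zero] at this
        rwa [dist_eq_norm]
      · rw [Submodule.Quotient.eq, LinearMap.mem_ker]
        simp [hAB]
  exact ⟨le_csSup ⟨_, hb⟩ hmem, csSup_le ⟨_, hmem⟩ hb⟩

/-- Volume comparison: covering the unit ball of `ℓ^q_N` by `K` balls of radius `ε` forces
`1 ≤ K ε ^ N`. -/
theorem one_le_card_mul_pow_of_cover {N K : ℕ} {ε : ℝ} (hε : 0 ≤ ε)
    (c : Fin K → PiLp q (fun _ : Fin N => ℝ)) (hc : ∀ g, ‖g‖ ≤ 1 → ∃ j, ‖g - c j‖ ≤ ε) :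
    1 ≤ (K : ℝ) * ε ^ N := by
  let G := PiLp q (fun _ : Fin N => ℝ)
  let : MeasurableSpace G := borel G
  have : BorelSpace G := ⟨rfl⟩
  let μ : Measure G := Measure.addHaar
  have hfin : Module.finrank ℝ G = N := by
    have := rank_piLp q N
    rw [← Module.finrank_eq_rank] at this
    exact_mod_cast this
  have hsub : Metric.closedBall (0 : G) 1 ⊆ ⋃ j, Metric.closedBall (c j) ε := by
    intro g hg
    obtain ⟨j, hj⟩ := hc g (by simpa using hg)
    exact mem_iUnion.2 ⟨j, by rw [Metric.mem_closedBall, dist_eq_norm]; exact hj⟩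
  have h1 := (measure_mono hsub).trans (measure_iUnion_le (μ := μ) _)
  rw [tsum_fintype] at h1
  simp only [Measure.addHaar_closedBall μ _ hε, Measure.addHaar_closedBall μ _ zero_le_one,
    one_pow, ofReal_one, one_mul, Finset.sum_const, Finset.card_univ, Fintype.card_fin,
    nsmul_eq_mul, hfin] at h1
  have hpos : μ (Metric.ball 0 1) ≠ 0 := (Metric.measure_ball_pos μ 0 one_pos).ne'
  have htop : μ (Metric.ball 0 1) ≠ ∞ := measure_ball_lt_top.ne
  rw [← mul_assoc] at h1
  nth_rewrite 1 [← one_mul (μ (Metric.ball 0 1))] at h1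
  have h2 := (ENNReal.mul_le_mul_iff_left hpos htop).1 h1
  rw [← ENNReal.ofReal_natCast, ← ENNReal.ofReal_mul (by positivity),
    ENNReal.one_le_ofReal] at h2
  exact h2

theorem le_entropyNumber (h : ∀ N, FactorsIdentity q T r N) (hr : 0 < r) :
    r ≤ entropyNumber m T := by
  refine le_csInf ⟨‖T‖ + 1, by positivity, fun _ => 0, fun x hx =>
    ⟨⟨0, by positivity⟩, ?_⟩⟩ ?_
  · rw [sub_zero]
    linarith [T.unit_le_opNorm x hx]
  · rintro ε ⟨hε, c, hc⟩
    by_contra! hlt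
    have hlim : Tendsto (fun N : ℕ => ((2 ^ (m - 1) : ℕ) : ℝ) * (ε / r) ^ N) atTop (𝓝 (_ * 0)) :=
      (_root_.tendsto_pow_atTop_nhds_zero_of_lt_one (by positivity)
        (by rwa [div_lt_one hr])).const_mul _
    rw [mul_zero] at hlim
    obtain ⟨N, hN⟩ := (hlim.eventually (gt_mem_nhds zero_lt_one)).exists
    obtain ⟨A, B, hAB, hA, hB⟩ := h N
    refine absurd (one_le_card_mul_pow_of_cover (q := q) (ε := ε / r) (by positivity)
      (fun j => A (c j)) fun g hg => ?_) (not_le.2 hN)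
    obtain ⟨j, hj⟩ := hc (B g) ((hB g).trans hg)
    refine ⟨j, ?_⟩
    rw [le_div_iff₀' hr]
    refine le_trans ?_ hj
    have := hA (T (B g) - c j)
    rwa [map_sub, hAB] at this

theorem entropyNumber_le_norm (m : ℕ) (hT : 0 < ‖T‖) : entropyNumber m T ≤ ‖T‖ :=
  csInf_le ⟨0, fun _ h => h.1.le⟩ ⟨hT, fun _ => 0, fun x hx =>
    ⟨⟨0, by positivity⟩, by rw [sub_zero]; exact T.unit_le_opNorm x hx⟩⟩

theorem approxNumber_le_norm (hm : 1 ≤ m) : approxNumber m T ≤ ‖T‖ := by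
  have hmem : ‖T‖ ∈ {r : ℝ | ∃ F : X →L[ℝ] Y,
      Module.rank ℝ (LinearMap.range (F : X →ₗ[ℝ] Y)) < (m : Cardinal) ∧ r = ‖T - F‖} := by
    refine ⟨0, ?_, by rw [sub_zero]⟩
    have : LinearMap.range ((0 : X →L[ℝ] Y) : X →ₗ[ℝ] Y) = ⊥ := LinearMap.range_zero
    rw [this, rank_bot]
    exact_mod_cast hm
  refine csInf_le ⟨0, ?_⟩ hmem
  rintro _ ⟨F, -, rfl⟩
  exact norm_nonneg _

theorem gelfandNumber_le_norm (hm : 1 ≤ m) : gelfandNumber m T ≤ ‖T‖ := by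
  have hmem : ‖T.comp (⊤ : Submodule ℝ X).subtypeL‖ ≤ ‖T‖ :=
    ContinuousLinearMap.opNorm_le_bound _ (norm_nonneg _) fun x => T.le_opNorm x
  refine le_trans (csInf_le ⟨0, ?_⟩ ⟨⊤, ?_, rfl⟩) hmem
  · rintro _ ⟨F, -, rfl⟩; positivity
  · rw [rank_subsingleton']
    exact_mod_cast hm

theorem kolmogorovNumber_le_norm (hm : 1 ≤ m) : kolmogorovNumber m T ≤ ‖T‖ := by
  refine csInf_le ⟨0, fun _ h => h.1⟩ ⟨norm_nonneg _, ⊥, ?_, ?_⟩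
  · rw [rank_bot]
    exact_mod_cast hm
  · intro x hx
    simp only [Submodule.bot_coe, Metric.infDist_singleton, dist_zero_right]
    exact T.unit_le_opNorm x hx

/-- If `T` factors the identities of all `ℓ^q_N` with constants arbitrarily close to `τ ≥ ‖T‖`,
then all the `s`-numbers and entropy numbers of `T` equal `‖T‖ = τ`. -/
theorem sNumbers_eq_of_factorsIdentity {τ : ℝ} (hτ : 0 < τ) (hT : ‖T‖ ≤ τ)
    (h : ∀ r, 0 < r → r < τ → ∀ N, FactorsIdentity q T r N) (hm : 1 ≤ m) :
    approxNumber m T = τ ∧ bernsteinNumber m T = τ ∧ gelfandNumber m T = τ ∧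
      kolmogorovNumber m T = τ ∧ isoNumber m T = τ ∧ mityaginNumber m T = τ ∧
      entropyNumber m T = τ ∧ ‖T‖ = τ := by
  have hle : ∀ {s : ℝ}, (∀ r, 0 < r → r < τ → r ≤ s) → τ ≤ s := by
    intro s hs
    refine le_of_forall_lt fun t ht => ?_
    obtain ⟨r, hr1, hr2⟩ := exists_between (max_lt ht hτ)
    exact (lt_of_le_of_lt (le_max_left _ _) hr1).trans_le
      (hs r (lt_of_le_of_lt (le_max_right _ _) hr1) hr2)
  have hnorm : ‖T‖ = τ := hT.antisymm <| hle fun r h0 h1 =>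
    let H := (h r h0 h1 m).le_bernsteinNumber h0 hm
    H.1.trans H.2
  obtain ⟨r₀, hr₀, hr₀'⟩ := exists_between hτ
  have h0 := h r₀ hr₀ hr₀' m
  refine ⟨?_, ?_, ?_, ?_, ?_, ?_, ?_, hnorm⟩
  · exact ((approxNumber_le_norm hm).trans hT).antisymm
      (hle fun r h0 h1 => (h r h0 h1 m).le_approxNumber h0 hm)
  · exact ((h0.le_bernsteinNumber hr₀ hm).2.trans hT).antisymm
      (hle fun r h0 h1 => ((h r h0 h1 m).le_bernsteinNumber h0 hm).1)
  · exact ((gelfandNumber_le_norm hm).trans hT).antisymm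
      (hle fun r h0 h1 => (h r h0 h1 m).le_gelfandNumber h0 hm)
  · exact ((kolmogorovNumber_le_norm hm).trans hT).antisymm
      (hle fun r h0 h1 => (h r h0 h1 m).le_kolmogorovNumber h0 hm)
  · exact ((h0.le_isoNumber hr₀ hm).2.trans hT).antisymm
      (hle fun r h0 h1 => ((h r h0 h1 m).le_isoNumber h0 hm).1)
  · exact ((h0.le_mityaginNumber hr₀ hm).2.trans hT).antisymm
      (hle fun r h0 h1 => ((h r h0 h1 m).le_mityaginNumber h0 hm).1)
  · exact ((entropyNumber_le_norm m (by rw [hnorm]; exact hτ)).trans hT).antisymm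
      (hle fun r h0 h1 => le_entropyNumber (h r h0 h1) h0)

end AbstractSNumbers

section GeneralizedCotangent

variable {p q : ℝ}

theorem intervalIntegrable_one_sub_rpow (hp : 1 < p) :
    IntervalIntegrable (fun s : ℝ => (1 - s ^ p) ^ (-1 / p)) volume 0 1 := by
  have hneg : -1 / p ≤ 0 := div_nonpos_of_nonpos_of_nonneg (by norm_num) (by linarith)
  have hgt : -1 < -1 / p := by
    rw [lt_div_iff₀ (by linarith)]
    linarith
  have h1 : IntervalIntegrable (fun s : ℝ => (1 - s) ^ (-1 / p)) volume 0 1 := by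
    have := (intervalIntegral.intervalIntegrable_rpow' (a := 1) (b := 0) hgt).comp_sub_left 1
    simpa using this
  refine h1.mono_fun (by fun_prop : Measurable _).aestronglyMeasurable ?_
  rw [uIoc_of_le zero_le_one]
  refine (ae_restrict_iff' measurableSet_Ioc).2 (Eventually.of_forall fun s hs => ?_)
  rcases hs.2.lt_or_eq with hs1 | rfl
  · have hsp : s ^ p ≤ s := by
      simpa using Real.rpow_le_rpow_of_exponent_ge hs.1 hs.2 hp.le
    have h2 : (1 - s ^ p) ^ (-1 / p) ≤ (1 - s) ^ (-1 / p) :=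
      Real.rpow_le_rpow_of_nonpos (by linarith) (by linarith) hneg
    beta_reduce
    rw [Real.norm_of_nonneg (Real.rpow_nonneg (by linarith) _),
      Real.norm_of_nonneg (Real.rpow_nonneg (by linarith) _)]
    exact h2
  · simp

theorem one_add_abs_rpow_pos (q y : ℝ) : 0 < 1 + |y| ^ q := by positivity

/-- The primitive of `1 / ((p - 1) (1 + |z| ^ q))`, the inverse of a generalized tangent. -/
noncomputable def arctanp (p q y : ℝ) : ℝ := ∫ z in (0 : ℝ)..y, ((p - 1) * (1 + |z| ^ q))⁻¹

theorem continuous_arctanp_integrand (hpq : p.HolderConjugate q) :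
    Continuous fun z : ℝ => ((p - 1) * (1 + |z| ^ q))⁻¹ := by
  have h1 : Continuous fun z : ℝ => |z| ^ q :=
    continuous_abs.rpow_const fun _ => Or.inr hpq.symm.nonneg
  refine Continuous.inv₀ (by fun_prop) fun z => ?_
  exact (mul_pos hpq.sub_one_pos (one_add_abs_rpow_pos q z)).ne'

theorem hasDerivAt_arctanp (hpq : p.HolderConjugate q) (y : ℝ) :
    HasDerivAt (arctanp p q) ((p - 1) * (1 + |y| ^ q))⁻¹ y :=
  (continuous_arctanp_integrand hpq).integral_hasStrictDerivAt 0 y |>.hasDerivAt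

theorem continuous_arctanp (hpq : p.HolderConjugate q) : Continuous (arctanp p q) :=
  continuous_iff_continuousAt.2 fun y => (hasDerivAt_arctanp hpq y).continuousAt

theorem strictMono_arctanp (hpq : p.HolderConjugate q) : StrictMono (arctanp p q) :=
  strictMono_of_hasDerivAt_pos (hasDerivAt_arctanp hpq) fun y =>
    inv_pos.2 (mul_pos hpq.sub_one_pos (one_add_abs_rpow_pos q y))

theorem arctanp_neg (p q y : ℝ) : arctanp p q (-y) = -arctanp p q y := by
  have := intervalIntegral.integral_comp_neg (a := 0) (b := y)
    (fun z : ℝ => ((p - 1) * (1 + |z| ^ q))⁻¹)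
  simp only [abs_neg, neg_zero] at this
  unfold arctanp
  rw [this, intervalIntegral.integral_symm]

theorem arctanp_add_integral (hpq : p.HolderConjugate q) {y : ℝ} (hy : 0 < y) :
    arctanp p q y + ∫ s in (0 : ℝ)..((1 + |y| ^ q) ^ (-1 / p)), (1 - s ^ p) ^ (-1 / p) =
      piP p / 2 := by
  have hp := hpq.lt
  have hp0 := hpq.pos
  have hint := intervalIntegrable_one_sub_rpow hp
  set σ : ℝ → ℝ := fun y => (1 + |y| ^ q) ^ (-1 / p) with hσ
  set F : ℝ → ℝ := fun t => ∫ s in (0 : ℝ)..t, (1 - s ^ p) ^ (-1 / p) with hF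
  have hneg : -1 / p < 0 := div_neg_of_neg_of_pos (by norm_num) hp0
  have hσ0 : ∀ y, 0 < σ y := fun y => Real.rpow_pos_of_pos (one_add_abs_rpow_pos q y) _
  have hσ1 : ∀ y, σ y ≤ 1 := fun y => Real.rpow_le_one_of_one_le_of_nonpos
    (by have : 0 ≤ |y| ^ q := by positivity
        linarith) hneg.le
  have hFc : ContinuousOn F (Icc 0 1) := by
    have := intervalIntegral.continuousOn_primitive_interval' hint left_mem_uIcc
    rwa [uIcc_of_le zero_le_one] at this
  have hσc : Continuous σ :=
    (continuous_const.add (continuous_abs.rpow_const fun _ => Or.inr hpq.symm.nonneg)).rpow_const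
      fun y => Or.inl (one_add_abs_rpow_pos q y).ne'
  have hcont : ContinuousOn (fun y => arctanp p q y + F (σ y)) (Icc 0 y) :=
    (continuous_arctanp hpq).continuousOn.add
      (hFc.comp hσc.continuousOn fun z _ => ⟨(hσ0 z).le, hσ1 z⟩)
  have hder : ∀ x ∈ Ioo 0 y, HasDerivAt (fun y => arctanp p q y + F (σ y)) 0 x := by
    intro x hx
    have hx0 : 0 < x := hx.1
    have hxq : 0 < x ^ q := Real.rpow_pos_of_pos hx0 q
    have hA := hasDerivAt_arctanp hpq x
    have hσx : HasDerivAt σ (q * x ^ (q - 1) * (-1 / p) * (1 + x ^ q) ^ (-1 / p - 1)) x := by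
      have h1 : HasDerivAt (fun y : ℝ => (1 + y ^ q) ^ (-1 / p))
          (q * x ^ (q - 1) * (-1 / p) * (1 + x ^ q) ^ (-1 / p - 1)) x := by
        have h2 : HasDerivAt (fun y : ℝ => 1 + y ^ q) (q * x ^ (q - 1)) x :=
          (Real.hasDerivAt_rpow_const (Or.inl hx0.ne')).const_add 1
        exact h2.rpow_const (Or.inl (by positivity))
      refine h1.congr_of_eventuallyEq ?_
      filter_upwards [lt_mem_nhds hx0] with z hz
      rw [hσ]
      simp only [abs_of_pos hz]
    have hσxe : σ x = (1 + x ^ q) ^ (-1 / p) := by simp only [hσ, abs_of_pos hx0]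
    have hσp : (σ x) ^ p = (1 + x ^ q)⁻¹ := by
      rw [hσxe, ← Real.rpow_mul (by positivity), div_mul_cancel₀ _ hp0.ne', Real.rpow_neg_one]
    have hbase : 1 - σ x ^ p = x ^ q / (1 + x ^ q) := by
      rw [hσp]; field_simp; ring
    have hσlt : σ x < 1 := by
      rw [hσxe]
      exact Real.rpow_lt_one_of_one_lt_of_neg (by linarith) hneg
    have hFx : HasDerivAt F ((1 - σ x ^ p) ^ (-1 / p)) (σ x) := by
      refine intervalIntegral.integral_hasDerivAt_right ?_ ?_ ?_
      · refine hint.mono_set ?_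
        rw [uIcc_of_le zero_le_one, uIcc_of_le (hσ0 x).le]
        exact Icc_subset_Icc_right (hσ1 x)
      · exact (by fun_prop : Measurable fun s : ℝ => (1 - s ^ p) ^ (-1 / p)).stronglyMeasurable
          |>.stronglyMeasurableAtFilter
      · refine ContinuousAt.rpow_const ?_ (Or.inl ?_)
        · exact continuousAt_const.sub
            (Real.continuousAt_rpow_const _ _ (Or.inl (hσ0 x).ne'))
        · rw [hbase]; positivity
    have h3 := hA.add (hFx.comp x hσx)
    have h3' : ((p - 1) * (1 + |x| ^ q))⁻¹ + (1 - σ x ^ p) ^ (-1 / p) *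
        (q * x ^ (q - 1) * (-1 / p) * (1 + x ^ q) ^ (-1 / p - 1)) = 0 := ?_
    · rw [h3'] at h3
      exact h3
    rw [hbase, abs_of_pos hx0, Real.div_rpow hxq.le (by positivity), ← Real.rpow_mul hx0.le,
      Real.rpow_sub (by positivity : 0 < 1 + x ^ q), Real.rpow_one]
    have e1 : q * (-1 / p) = -(q - 1) := by
      have := hpq.symm.div_conj_eq_sub_one
      rw [← this]; ring
    rw [e1, Real.rpow_neg hx0.le]
    have h4 : 0 < (1 + x ^ q) ^ (-1 / p) := by positivity
    have h5 : 0 < x ^ (q - 1) := by positivity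
    have h6 : (q / p) * (p - 1) = 1 := by
      rw [hpq.symm.div_conj_eq_sub_one]
      have := hpq.mul_eq_add
      linear_combination this
    have h7 := hpq.sub_one_pos
    field_simp
    field_simp at h6
    linear_combination -h6
  obtain ⟨c, hc, hc'⟩ := exists_hasDerivAt_eq_slope _ (fun _ => (0 : ℝ)) hy hcont hder
  have h0 : arctanp p q 0 + F (σ 0) = piP p / 2 := by
    have : σ 0 = 1 := by simp [hσ, Real.zero_rpow hpq.symm.ne_zero]
    rw [this, hF]
    simp [arctanp, piP]
  have hsub : (y - 0) ≠ 0 := by linarith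
  rw [eq_comm, div_eq_iff hsub, zero_mul] at hc'
  rw [← h0]
  exact sub_eq_zero.1 hc'

theorem tendsto_arctanp_atTop (hpq : p.HolderConjugate q) :
    Tendsto (arctanp p q) atTop (𝓝 (piP p / 2)) := by
  have hp0 := hpq.pos
  have hint := intervalIntegrable_one_sub_rpow hpq.lt
  have hFc := intervalIntegral.continuousOn_primitive_interval' hint left_mem_uIcc
  rw [uIcc_of_le zero_le_one] at hFc
  have hneg : -1 / p < 0 := div_neg_of_neg_of_pos (by norm_num) hp0
  have hσ : Tendsto (fun y : ℝ => (1 + |y| ^ q) ^ (-1 / p)) atTop (𝓝[Icc 0 1] 0) := by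
    refine tendsto_nhdsWithin_iff.2 ⟨?_, Eventually.of_forall fun y => ⟨by positivity, ?_⟩⟩
    · have h1 : Tendsto (fun y : ℝ => 1 + |y| ^ q) atTop atTop :=
        tendsto_atTop_add_const_left _ _
          ((tendsto_rpow_atTop hpq.symm.pos).comp tendsto_abs_atTop_atTop)
      have h2 := (tendsto_rpow_neg_atTop (y := 1 / p) (by positivity)).comp h1
      simpa [Function.comp_def, neg_div] using h2
    · exact Real.rpow_le_one_of_one_le_of_nonpos
        (by have : 0 ≤ |y| ^ q := by positivity
            linarith) hneg.le
  have hlim := ((hFc 0 ⟨le_rfl, zero_le_one⟩).tendsto.comp hσ).const_sub (piP p / 2)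
  simp only [intervalIntegral.integral_same, sub_zero] at hlim
  refine hlim.congr' ?_
  filter_upwards [eventually_gt_atTop 0] with y hy
  rw [← arctanp_add_integral hpq hy]
  simp

theorem arctanp_lt (hpq : p.HolderConjugate q) (y : ℝ) : arctanp p q y < piP p / 2 :=
  (strictMono_arctanp hpq (lt_add_one y)).trans_le
    ((strictMono_arctanp hpq).monotone.ge_of_tendsto (tendsto_arctanp_atTop hpq) _)

theorem piP_pos (hpq : p.HolderConjugate q) : 0 < piP p := by
  have h := arctanp_lt hpq 0
  simp only [arctanp, intervalIntegral.integral_same] at h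
  linarith

/-- The inverse of `arctanp`. -/
noncomputable def tanp (p q : ℝ) : ℝ → ℝ := Function.invFun (arctanp p q)

theorem tanp_arctanp (hpq : p.HolderConjugate q) (y : ℝ) : tanp p q (arctanp p q y) = y :=
  Function.leftInverse_invFun (strictMono_arctanp hpq).injective y

theorem arctanp_tanp (hpq : p.HolderConjugate q) {t : ℝ}
    (ht : t ∈ Ioo (-(piP p / 2)) (piP p / 2)) : arctanp p q (tanp p q t) = t := by
  refine Function.invFun_eq ?_
  refine mem_range_of_exists_le_of_exists_ge (continuous_arctanp hpq) ?_ ?_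
  · have h1 : -t < piP p / 2 := by linarith [ht.1]
    obtain ⟨y, hy⟩ := ((tendsto_arctanp_atTop hpq).eventually (lt_mem_nhds h1)).exists
    exact ⟨-y, by rw [arctanp_neg]; linarith⟩
  · obtain ⟨y, hy⟩ := ((tendsto_arctanp_atTop hpq).eventually (lt_mem_nhds ht.2)).exists
    exact ⟨y, hy.le⟩

theorem arctanp_mem (hpq : p.HolderConjugate q) (y : ℝ) :
    arctanp p q y ∈ Ioo (-(piP p / 2)) (piP p / 2) := by
  refine ⟨?_, arctanp_lt hpq y⟩
  have := arctanp_lt hpq (-y)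
  rw [arctanp_neg] at this
  linarith

theorem strictMonoOn_tanp (hpq : p.HolderConjugate q) :
    StrictMonoOn (tanp p q) (Ioo (-(piP p / 2)) (piP p / 2)) := by
  intro s hs t ht hst
  rw [← (strictMono_arctanp hpq).lt_iff_lt, arctanp_tanp hpq hs, arctanp_tanp hpq ht]
  exact hst

theorem hasDerivAt_tanp (hpq : p.HolderConjugate q) {t : ℝ}
    (ht : t ∈ Ioo (-(piP p / 2)) (piP p / 2)) :
    HasDerivAt (tanp p q) ((p - 1) * (1 + |tanp p q t| ^ q)) t := by
  have hmem : Ioo (-(piP p / 2)) (piP p / 2) ∈ 𝓝 t := isOpen_Ioo.mem_nhds ht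
  have himg : tanp p q '' Ioo (-(piP p / 2)) (piP p / 2) = univ :=
    eq_univ_of_forall fun y => ⟨arctanp p q y, arctanp_mem hpq y, tanp_arctanp hpq y⟩
  have hcont : ContinuousAt (tanp p q) t :=
    (strictMonoOn_tanp hpq).continuousAt_of_image_mem_nhds hmem (by rw [himg]; exact univ_mem)
  have hpos := mul_pos hpq.sub_one_pos (one_add_abs_rpow_pos q (tanp p q t))
  have := HasDerivAt.of_local_left_inverse hcont (hasDerivAt_arctanp hpq (tanp p q t))
    (inv_pos.2 hpos).ne' (by filter_upwards [hmem] with s hs using arctanp_tanp hpq hs)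
  rwa [inv_inv] at this

/-- The solution on `(a, b)` of the Riccati-type equation attached to the first Dirichlet
eigenfunction of the one-dimensional `p`-Laplacian. -/
theorem exists_riccati (hpq : p.HolderConjugate q) {a b : ℝ} (hab : a < b) :
    ∃ Y : ℝ → ℝ,
      (∀ t ∈ Ioo a b, HasDerivAt Y (piP p / (b - a) * ((p - 1) * (1 + |Y t| ^ q))) t) ∧
      ∀ M, 0 < M → ∃ c d, a < c ∧ c < d ∧ d < b ∧ Y c = -M ∧ Y d = M ∧
        ∀ t ∈ Ioo a b, t ∉ Icc c d → M < |Y t| := by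
  have hπ := piP_pos hpq
  have hba : 0 < b - a := sub_pos.2 hab
  set κ := piP p / (b - a) with hκ
  have hκ0 : 0 < κ := by positivity
  have hκba : κ * (b - a) = piP p := by rw [hκ]; field_simp
  let ℓ : ℝ → ℝ := fun t => κ * (t - (a + b) / 2)
  have hℓ : ∀ t ∈ Ioo a b, ℓ t ∈ Ioo (-(piP p / 2)) (piP p / 2) := by
    intro t ht
    have h1 := mul_pos hκ0 (sub_pos.2 ht.1)
    have h2 := mul_pos hκ0 (sub_pos.2 ht.2)
    constructor <;> simp only [ℓ] <;> nlinarith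
  refine ⟨fun t => tanp p q (ℓ t), fun t ht => ?_, fun M hM => ?_⟩
  · have h1 : HasDerivAt ℓ κ t := by
      simpa using ((hasDerivAt_id t).sub_const ((a + b) / 2)).const_mul κ
    have := (hasDerivAt_tanp hpq (hℓ t ht)).comp t h1
    rw [mul_comm]
    exact this
  · have hinv : ∀ y, ℓ (y / κ + (a + b) / 2) = y := by
      intro y; simp only [ℓ]; field_simp; ring
    have hA := arctanp_mem hpq M
    have hA0 : 0 < arctanp p q M := by
      have := strictMono_arctanp hpq hM
      simpa [arctanp] using this
    have hdiv : arctanp p q M / κ < (b - a) / 2 := by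
      rw [div_lt_iff₀ hκ0]
      linarith [hA.2]
    have hdiv0 : 0 < arctanp p q M / κ := by positivity
    refine ⟨arctanp p q (-M) / κ + (a + b) / 2, arctanp p q M / κ + (a + b) / 2,
      ?_, ?_, ?_, ?_, ?_, ?_⟩
    · rw [arctanp_neg, neg_div]; linarith
    · rw [arctanp_neg, neg_div]; linarith
    · linarith
    · simp only [hinv, tanp_arctanp hpq]
    · simp only [hinv, tanp_arctanp hpq]
    · intro t ht htn
      rw [arctanp_neg, neg_div, mem_Icc, not_and_or, not_le, not_le] at htn
      have e : arctanp p q (tanp p q (ℓ t)) = ℓ t := arctanp_tanp hpq (hℓ t ht)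
      have e2 : ℓ t / κ = t - (a + b) / 2 := by simp only [ℓ]; field_simp
      rw [lt_abs]
      rcases htn with h | h
      · right
        rw [← (strictMono_arctanp hpq).lt_iff_lt, arctanp_neg, e]
        have h3 : ℓ t / κ < -(arctanp p q M / κ) := by rw [e2]; linarith
        rw [← neg_div, div_lt_div_iff_of_pos_right hκ0] at h3
        linarith
      · left
        rw [← (strictMono_arctanp hpq).lt_iff_lt, e]
        have h3 : arctanp p q M / κ < ℓ t / κ := by rw [e2]; linarith
        rwa [div_lt_div_iff_of_pos_right hκ0] at h3

end GeneralizedCotangent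

section Poincare

variable {p q : ℝ}

theorem contDiffOn_riccati (hpq : p.HolderConjugate q) {a b κ : ℝ} {Y : ℝ → ℝ}
    (hY : ∀ t ∈ Ioo a b, HasDerivAt Y (κ * ((p - 1) * (1 + |Y t| ^ q))) t) :
    ContDiffOn ℝ 1 Y (Ioo a b) := by
  have hc : ContinuousOn Y (Ioo a b) := fun t ht => (hY t ht).continuousAt.continuousWithinAt
  rw [show (1 : WithTop ℕ∞) = 0 + 1 from (zero_add 1).symm,
    contDiffOn_succ_iff_deriv_of_isOpen isOpen_Ioo]
  refine ⟨fun t ht => (hY t ht).differentiableAt.differentiableWithinAt, by simp, ?_⟩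
  rw [contDiffOn_zero]
  refine ContinuousOn.congr (f := fun t => κ * ((p - 1) * (1 + |Y t| ^ q))) ?_
    fun t ht => (hY t ht).deriv
  have h1 : ContinuousOn (fun t => |Y t| ^ q) (Ioo a b) :=
    hc.abs.rpow_const fun _ _ => Or.inr hpq.symm.nonneg
  fun_prop

/-- Young's inequality in the form of Picone's identity. -/
theorem picone_le (hpq : p.HolderConjugate q) {κ : ℝ} (hκ : 0 ≤ κ) (u u' y : ℝ) :
    p * |u| ^ (p - 2) * u * u' * (-(κ ^ (p - 1)) * y) +
      |u| ^ p * (-(κ ^ (p - 1)) * (κ * ((p - 1) * (1 + |y| ^ q)))) ≤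
      |u'| ^ p - (p - 1) * κ ^ p * |u| ^ p := by
  have hp := hpq.pos
  have hκp : κ ^ (p - 1) * κ = κ ^ p := by
    rw [← Real.rpow_add_one' hκ (by linarith [hpq.pos]), sub_add_cancel]
  have hpow : ∀ {s : ℝ}, 0 ≤ s → (s ^ (p - 1)) ^ q = s ^ p := by
    intro s hs
    rw [← Real.rpow_mul hs, hpq.sub_one_mul_conj]
  have hu : |(|u| ^ (p - 2) * u)| = |u| ^ (p - 1) := by
    rw [abs_mul, abs_of_nonneg (by positivity : 0 ≤ |u| ^ (p - 2)),
      ← Real.rpow_add_one' (abs_nonneg u) (by linarith [hpq.sub_one_pos])]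
    congr 1; ring
  have hy := Real.young_inequality_of_nonneg (a := |u'|)
    (b := |u| ^ (p - 1) * κ ^ (p - 1) * |y|) (abs_nonneg _) (by positivity) hpq
  have e1 : (|u| ^ (p - 1) * κ ^ (p - 1) * |y|) ^ q = |u| ^ p * κ ^ p * |y| ^ q := by
    rw [Real.mul_rpow (by positivity) (by positivity), Real.mul_rpow (by positivity) (by positivity),
      hpow (abs_nonneg _), hpow hκ]
  rw [e1] at hy
  have h2 : (|u| ^ (p - 2) * u) * u' * (-(κ ^ (p - 1)) * y) ≤
      |u'| * (|u| ^ (p - 1) * κ ^ (p - 1) * |y|) := by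
    refine (le_abs_self _).trans (le_of_eq ?_)
    rw [abs_mul, abs_mul, hu, abs_mul, abs_neg, abs_of_nonneg (by positivity : 0 ≤ κ ^ (p - 1))]
    ring
  have h3 := mul_le_mul_of_nonneg_left (h2.trans hy) hp.le
  have h4 : p * (|u'| ^ p / p + |u| ^ p * κ ^ p * |y| ^ q / q) =
      |u'| ^ p + (p - 1) * (|u| ^ p * κ ^ p * |y| ^ q) := by
    rw [← hpq.div_conj_eq_sub_one]
    have := hpq.symm.pos
    field_simp
  rw [h4] at h3
  rw [show |u| ^ p * (-(κ ^ (p - 1)) * (κ * ((p - 1) * (1 + |y| ^ q)))) =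
    -(κ ^ (p - 1) * κ) * |u| ^ p * (p - 1) * (1 + |y| ^ q) by ring, hκp]
  linarith

theorem integral_fderiv_eq_zero_of_hasCompactSupport {n : ℕ} {G : (Fin n → ℝ) → ℝ}
    (hG : ContDiff ℝ 1 G) (hc : HasCompactSupport G) (v : Fin n → ℝ) :
    ∫ x, fderiv ℝ G x v = 0 := by
  have h := integral_mul_fderiv_eq_neg_fderiv_mul_of_integrable (μ := volume)
    (f := fun _ : Fin n → ℝ => (1 : ℝ)) (g := G) (v := v) (by simp)
    (by
      simp only [one_mul]
      exact ((hG.continuous_fderiv one_ne_zero).clm_apply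
        continuous_const).integrable_of_hasCompactSupport (hc.fderiv_apply ℝ v))
    (by simpa using hG.continuous.integrable_of_hasCompactSupport hc)
    (fun _ _ => by fun_prop) (fun x _ => (hG.differentiable one_ne_zero) x)
  simpa using h

theorem integrable_abs_rpow {n : ℕ} (hp : 0 < p) {u : (Fin n → ℝ) → ℝ} (hu : Continuous u)
    (hc : HasCompactSupport u) : Integrable (fun x => |u x| ^ p) := by
  refine Continuous.integrable_of_hasCompactSupport
    (hu.abs.rpow_const fun _ => Or.inr hp.le) ?_
  refine hc.comp_left (g := fun y : ℝ => |y| ^ p) ?_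
  simp [Real.zero_rpow hp.ne']

theorem IsTestFun.continuous_pder {n : ℕ} {D : Set (Fin n → ℝ)} {u : (Fin n → ℝ) → ℝ}
    (hu : IsTestFun D u) (i : Fin n) : Continuous (pder i u) :=
  (hu.1.continuous_fderiv (by simp)).clm_apply continuous_const

theorem IsTestFun.hasCompactSupport_pder {n : ℕ} {D : Set (Fin n → ℝ)} {u : (Fin n → ℝ) → ℝ}
    (hu : IsTestFun D u) (i : Fin n) : HasCompactSupport (pder i u) :=
  hu.2.1.fderiv_apply ℝ _

/-- The sharp one-directional `p`-Poincaré inequality on a slab. -/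
theorem poincare_slab (hpq : p.HolderConjugate q) {n : ℕ} (i : Fin n) {a b : ℝ} (hab : a < b)
    {D : Set (Fin n → ℝ)} (hD : ∀ x ∈ D, x i ∈ Ioo a b) {u : (Fin n → ℝ) → ℝ}
    (hu : IsTestFun D u) :
    (p - 1) * (piP p / (b - a)) ^ p * ∫ x, |u x| ^ p ≤ ∫ x, |pder i u x| ^ p := by
  obtain ⟨Y, hY, -⟩ := exists_riccati hpq hab
  have hκ : 0 ≤ piP p / (b - a) := div_nonneg (piP_pos hpq).le (sub_pos.2 hab).le
  set κ := piP p / (b - a)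
  have hYc := contDiffOn_riccati hpq hY
  let G : (Fin n → ℝ) → ℝ := fun x => |u x| ^ p * (-(κ ^ (p - 1)) * Y (x i))
  have hu1 : ContDiff ℝ 1 u := hu.1.of_le (by norm_cast)
  have hcase : ∀ x, x i ∈ Ioo a b ∨ u =ᶠ[𝓝 x] 0 := by
    intro x
    by_cases hx : x ∈ tsupport u
    · exact Or.inl (hD x (hu.2.2 hx))
    · exact Or.inr (notMem_tsupport_iff_eventuallyEq.1 hx)
  have hG0 : ∀ {x}, u =ᶠ[𝓝 x] 0 → G =ᶠ[𝓝 x] fun _ => 0 := by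
    intro x hx
    filter_upwards [hx] with z hz
    simp [G, hz, Real.zero_rpow hpq.ne_zero]
  have hG : ContDiff ℝ 1 G := by
    rw [contDiff_iff_contDiffAt]
    intro x
    rcases hcase x with hx | hx
    · have h1 : ContDiffAt ℝ 1 (fun x => |u x| ^ p) x :=
        ((contDiff_norm_rpow (E := ℝ) hpq.lt).comp hu1).contDiffAt
      have h2 : ContDiffAt ℝ 1 (fun x : Fin n → ℝ => Y (x i)) x :=
        ContDiffAt.comp (g := Y) x (hYc.contDiffAt (isOpen_Ioo.mem_nhds hx))
          (contDiff_apply ℝ ℝ i).contDiffAt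
      exact h1.mul (contDiffAt_const.mul h2)
    · exact contDiffAt_const.congr_of_eventuallyEq (hG0 hx)
  have hGc : HasCompactSupport G := by
    refine hu.2.1.mono fun x hx => ?_
    contrapose! hx
    simp only [Function.mem_support, not_not] at hx
    simp [G, hx, Real.zero_rpow hpq.ne_zero]
  have hpt : ∀ x, fderiv ℝ G x (Pi.single i 1) ≤
      |pder i u x| ^ p - (p - 1) * κ ^ p * |u x| ^ p := by
    intro x
    rcases hcase x with hx | hx
    · refine le_of_eq_of_le ?_ (picone_le hpq hκ (u x) (pder i u x) (Y (x i)))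
      have hux : HasFDerivAt u (fderiv ℝ u x) x := (hu1.differentiable one_ne_zero x).hasFDerivAt
      have h1 := (hasDerivAt_abs_rpow (u x) hpq.lt).comp_hasFDerivAt x hux
      have h2 : HasFDerivAt (fun x : Fin n → ℝ => x i)
          (ContinuousLinearMap.proj (R := ℝ) (φ := fun _ : Fin n => ℝ) i) x :=
        hasFDerivAt_apply i x
      have h3 := ((hY _ hx).comp_hasFDerivAt x h2).const_mul (-(κ ^ (p - 1)))
      have h4 : HasFDerivAt G _ x := h1.mul h3
      rw [h4.fderiv]
      simp [pder]
      ring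
    · rw [(hG0 hx).fderiv_eq]
      have : u x = 0 := hx.self_of_nhds
      simp only [this, abs_zero, Real.zero_rpow hpq.ne_zero]
      simp
      positivity
  have hi1 := integrable_abs_rpow hpq.pos hu1.continuous hu.2.1
  have hi2 := integrable_abs_rpow hpq.pos (hu.continuous_pder i) (hu.hasCompactSupport_pder i)
  have hi3 : Integrable fun x => fderiv ℝ G x (Pi.single i 1) :=
    ((hG.continuous_fderiv one_ne_zero).clm_apply
      continuous_const).integrable_of_hasCompactSupport (hGc.fderiv_apply ℝ _)
  have hmono := integral_mono hi3 (hi2.sub (hi1.const_mul ((p - 1) * κ ^ p))) hpt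
  rw [integral_fderiv_eq_zero_of_hasCompactSupport hG hGc] at hmono
  simp only [Pi.sub_apply] at hmono
  rw [integral_sub hi2 (hi1.const_mul _), integral_const_mul] at hmono
  linarith

end Poincare

section NearExtremal

variable {p q : ℝ}

theorem hasDerivAt_riccati_profile (hpq : p.HolderConjugate q) {κ t : ℝ} {Y : ℝ → ℝ}
    (hY : HasDerivAt Y (κ * ((p - 1) * (1 + |Y t| ^ q))) t) :
    HasDerivAt (fun s => (1 + |Y s| ^ q) ^ (-1 / p))
      (-κ * (|Y t| ^ (q - 2) * Y t * (1 + |Y t| ^ q) ^ (-1 / p))) t := by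
  have hw := one_add_abs_rpow_pos q (Y t)
  have h1 : HasDerivAt (fun s => 1 + |Y s| ^ q) _ t :=
    ((hasDerivAt_abs_rpow (Y t) hpq.symm.lt).comp t hY).const_add 1
  convert h1.rpow_const (p := -1 / p) (Or.inl hw.ne') using 1
  rw [Real.rpow_sub_one hw.ne']
  have hp := hpq.pos
  have h2 : (p - 1) * q = p := hpq.sub_one_mul_conj
  field_simp
  linear_combination κ * |Y t| ^ (q - 2) * Y t * h2

theorem abs_riccati_profile_deriv_rpow (hpq : p.HolderConjugate q) {κ : ℝ} (hκ : 0 ≤ κ) (y : ℝ) :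
    |-κ * (|y| ^ (q - 2) * y * (1 + |y| ^ q) ^ (-1 / p))| ^ p =
      κ ^ p * (|y| ^ q * (1 + |y| ^ q)⁻¹) := by
  have hw := one_add_abs_rpow_pos q y
  have hp := hpq.pos
  have h1 : |(|y| ^ (q - 2) * y)| = |y| ^ (q - 1) := by
    rw [abs_mul, abs_of_nonneg (by positivity : 0 ≤ |y| ^ (q - 2)),
      ← Real.rpow_add_one' (abs_nonneg y) (by linarith [hpq.symm.sub_one_pos])]
    congr 1; ring
  rw [abs_mul, abs_mul, h1, abs_neg, abs_of_nonneg hκ, abs_of_nonneg (by positivity :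
    0 ≤ (1 + |y| ^ q) ^ (-1 / p)), Real.mul_rpow hκ (by positivity),
    Real.mul_rpow (by positivity) (by positivity), ← Real.rpow_mul (abs_nonneg y),
    hpq.symm.sub_one_mul_conj, ← Real.rpow_mul hw.le, div_mul_cancel₀ _ hp.ne', Real.rpow_neg_one]

theorem hasDerivAt_riccati_flux (hpq : p.HolderConjugate q) {κ t : ℝ} {Y : ℝ → ℝ}
    (hY : HasDerivAt Y (κ * ((p - 1) * (1 + |Y t| ^ q))) t) :
    HasDerivAt (fun s => Y s / (1 + |Y s| ^ q))
      (κ * ((p - 1) * (1 + |Y t| ^ q)⁻¹ - |Y t| ^ q * (1 + |Y t| ^ q)⁻¹)) t := by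
  have hw := one_add_abs_rpow_pos q (Y t)
  have h1 : HasDerivAt (fun s => 1 + |Y s| ^ q) _ t :=
    ((hasDerivAt_abs_rpow (Y t) hpq.symm.lt).comp t hY).const_add 1
  have h3 : |Y t| ^ (q - 2) * (Y t * Y t) = |Y t| ^ q := by
    rw [← abs_mul_abs_self (Y t), ← mul_assoc,
      ← Real.rpow_add_one' (abs_nonneg _) (by linarith [hpq.symm.sub_one_pos]),
      ← Real.rpow_add_one' (abs_nonneg _) (by linarith [hpq.symm.pos])]
    congr 1; ring
  refine (hY.div h1 hw.ne').congr_deriv ?_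
  have h2 : (p - 1) * q = p := hpq.sub_one_mul_conj
  rw [show Y t * (q * |Y t| ^ (q - 2) * Y t * (κ * ((p - 1) * (1 + |Y t| ^ q)))) =
    ((p - 1) * q) * (|Y t| ^ (q - 2) * (Y t * Y t)) * (κ * (1 + |Y t| ^ q)) by ring, h3, h2]
  field_simp
  ring

/-- The energy of the truncated extremal profile is at most that of the full profile. -/
theorem integral_riccati_profile_le (hpq : p.HolderConjugate q) {κ c d : ℝ} (hκ : 0 ≤ κ)
    (hcd : c ≤ d) {Y : ℝ → ℝ}
    (hY : ∀ t ∈ Icc c d, HasDerivAt Y (κ * ((p - 1) * (1 + |Y t| ^ q))) t)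
    (hc : Y c ≤ 0) (hd : 0 ≤ Y d) :
    ∫ t in c..d, κ ^ p * (|Y t| ^ q * (1 + |Y t| ^ q)⁻¹) ≤
      (p - 1) * κ ^ p * ∫ t in c..d, (1 + |Y t| ^ q)⁻¹ := by
  have hκp : κ ^ (p - 1) * κ = κ ^ p := by
    rw [← Real.rpow_add_one' hκ (by linarith [hpq.pos]), sub_add_cancel]
  have hYc : ContinuousOn Y (Icc c d) := fun t ht => (hY t ht).continuousAt.continuousWithinAt
  have h1 : ContinuousOn (fun t => |Y t| ^ q) (Icc c d) :=
    hYc.abs.rpow_const fun _ _ => Or.inr hpq.symm.nonneg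
  have h2 : ContinuousOn (fun t => (1 + |Y t| ^ q)⁻¹) (Icc c d) :=
    (h1.const_add 1).inv₀ fun t _ => (one_add_abs_rpow_pos q (Y t)).ne'
  rw [← uIcc_of_le hcd] at h1 h2
  have hI1 := h2.intervalIntegrable (μ := volume)
  have hI2 := (h1.mul h2).intervalIntegrable (μ := volume)
  have hI3 : IntervalIntegrable (fun t => κ * ((p - 1) * (1 + |Y t| ^ q)⁻¹ -
      |Y t| ^ q * (1 + |Y t| ^ q)⁻¹)) volume c d :=
    ((hI1.const_mul (p - 1)).sub hI2).const_mul κ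
  have hft := intervalIntegral.integral_eq_sub_of_hasDerivAt
    (fun t ht => hasDerivAt_riccati_flux hpq (hY t (uIcc_of_le hcd ▸ ht))) hI3
  have hmono : 0 ≤ Y d / (1 + |Y d| ^ q) - Y c / (1 + |Y c| ^ q) := by
    have := div_nonneg hd (one_add_abs_rpow_pos q (Y d)).le
    have := div_nonpos_of_nonpos_of_nonneg hc (one_add_abs_rpow_pos q (Y c)).le
    linarith
  rw [← hft] at hmono
  have h3 : ∫ t in c..d, κ ^ p * (|Y t| ^ q * (1 + |Y t| ^ q)⁻¹) =
      ∫ t in c..d, ((p - 1) * κ ^ p * (1 + |Y t| ^ q)⁻¹ - κ ^ (p - 1) *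
        (κ * ((p - 1) * (1 + |Y t| ^ q)⁻¹ - |Y t| ^ q * (1 + |Y t| ^ q)⁻¹))) := by
    congr 1
    ext t
    rw [← hκp]
    ring
  rw [h3, intervalIntegral.integral_sub (hI1.const_mul _) (hI3.const_mul _),
    intervalIntegral.integral_const_mul, intervalIntegral.integral_const_mul]
  have := mul_nonneg (Real.rpow_nonneg hκ (p - 1)) hmono
  linarith

/-- A `C¹` soft threshold at level `δ`. -/
theorem exists_softThreshold {δ : ℝ} (hδ : 0 < δ) :
    ∃ ψ η : ℝ → ℝ, Continuous η ∧ (∀ s, HasDerivAt ψ (η s) s) ∧ (∀ s, 0 ≤ η s ∧ η s ≤ 1) ∧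
      (∀ s ≤ δ, ψ s = 0) ∧ ∀ s, 0 ≤ s → 0 ≤ ψ s ∧ ψ s ≤ s ∧ s - ψ s ≤ 2 * δ := by
  let η : ℝ → ℝ := fun s => max 0 (min 1 ((s - δ) / δ))
  have hη : Continuous η := by fun_prop
  have hη01 : ∀ s, 0 ≤ η s ∧ η s ≤ 1 := fun s =>
    ⟨le_max_left _ _, max_le zero_le_one (min_le_left _ _)⟩
  have hI : ∀ x y, IntervalIntegrable η volume x y := fun x y => hη.intervalIntegrable x y
  refine ⟨fun s => ∫ x in (0 : ℝ)..s, η x, η, hη,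
    fun s => (hη.integral_hasStrictDerivAt 0 s).hasDerivAt, hη01, fun s hs => ?_, fun s hs => ?_⟩
  · change ∫ x in (0 : ℝ)..s, η x = 0
    rw [intervalIntegral.integral_congr (g := fun _ => (0 : ℝ)), intervalIntegral.integral_zero]
    intro x hx
    have hxδ : x ≤ δ := hx.2.trans (max_le hδ.le hs)
    have : (x - δ) / δ ≤ 0 := div_nonpos_of_nonpos_of_nonneg (by linarith) hδ.le
    exact max_eq_left ((min_le_right _ _).trans this)
  · have hnn : ∀ {r}, 0 ≤ r → 0 ≤ ∫ x in (0 : ℝ)..r, η x := fun hr =>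
      intervalIntegral.integral_nonneg hr fun x _ => (hη01 x).1
    refine ⟨hnn hs, ?_, ?_⟩
    · have := intervalIntegral.integral_mono_on hs (hI 0 s)
        (intervalIntegrable_const (c := (1 : ℝ))) fun x _ => (hη01 x).2
      simpa using this
    · rcases le_total s (2 * δ) with h | h
      · have := hnn hs
        linarith
      · have h1 := intervalIntegral.integral_add_adjacent_intervals (hI 0 (2 * δ)) (hI (2 * δ) s)
        have h2 : ∫ x in (2 * δ)..s, η x = s - 2 * δ := by
          rw [intervalIntegral.integral_congr (g := fun _ => (1 : ℝ))]
          · simp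
          intro x hx
          rw [uIcc_of_le h] at hx
          have : 1 ≤ (x - δ) / δ := by rw [le_div_iff₀ hδ]; linarith [hx.1]
          simp [η, min_eq_left this]
        have := hnn (r := 2 * δ) (by linarith)
        linarith

theorem rpow_sub_rpow_le (hp : 1 ≤ p) {u g : ℝ} (hg : 0 ≤ g) (hgu : g ≤ u) (hu : u ≤ 1) :
    u ^ p - g ^ p ≤ p * (u - g) := by
  rcases (hg.trans hgu).eq_or_lt with h | h
  · have : g = 0 := le_antisymm (h ▸ hgu) hg
    subst this; subst h; simp
  have h1 := one_add_mul_self_le_rpow_one_add (s := (g - u) / u)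
    (by rw [le_div_iff₀ h]; linarith) hp
  have h2 : 1 + (g - u) / u = g / u := by field_simp; ring
  rw [h2, Real.div_rpow hg h.le, le_div_iff₀ (by positivity)] at h1
  have h3 : u ^ p = u ^ (p - 1) * u := by
    rw [← Real.rpow_add_one h.ne', sub_add_cancel]
  have h4 : u ^ (p - 1) ≤ 1 := Real.rpow_le_one h.le hu (by linarith)
  have h5 : (1 + p * ((g - u) / u)) * u ^ p = u ^ p - u ^ (p - 1) * (p * (u - g)) := by
    rw [h3]; field_simp; ring
  rw [h5] at h1
  have h6 := mul_le_mul_of_nonneg_right h4 (by nlinarith : 0 ≤ p * (u - g))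
  linarith

end NearExtremal

section NearExtremalSmooth

variable {p q : ℝ}

theorem integral_abs_rpow_eq_intervalIntegral (hp : 0 < p) {f : ℝ → ℝ} {c d : ℝ} (hcd : c ≤ d)
    (h0 : ∀ t ∉ Icc c d, f t = 0) : ∫ t, |f t| ^ p = ∫ t in c..d, |f t| ^ p := by
  rw [intervalIntegral.integral_of_le hcd, ← integral_Icc_eq_integral_Ioc,
    setIntegral_eq_integral_of_forall_compl_eq_zero]
  intro t ht
  rw [h0 t ht, abs_zero, Real.zero_rpow hp.ne']

theorem exists_contDiff_one_near_extremal (hpq : p.HolderConjugate q) {a b ε : ℝ} (hab : a < b)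
    (hε : 0 < ε) :
    ∃ g : ℝ → ℝ, ContDiff ℝ 1 g ∧ (∃ c d, a < c ∧ c < d ∧ d < b ∧ ∀ t ∉ Icc c d, g t = 0) ∧
      0 < ∫ t, |g t| ^ p ∧
      ∫ t, |deriv g t| ^ p < ((p - 1) * (piP p / (b - a)) ^ p + ε) * ∫ t, |g t| ^ p := by
  have hp := hpq.pos
  obtain ⟨Y, hY, hM⟩ := exists_riccati hpq hab
  have hκ : 0 ≤ piP p / (b - a) := div_nonneg (piP_pos hpq).le (sub_pos.2 hab).le
  have hYc := contDiffOn_riccati hpq hY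
  generalize piP p / (b - a) = κ at *
  have hw : ∀ t, 0 < 1 + |Y t| ^ q := fun t => one_add_abs_rpow_pos q (Y t)
  let v : ℝ → ℝ := fun t => (1 + |Y t| ^ q)⁻¹
  have hv0 : ∀ t, 0 < v t := fun t => inv_pos.2 (hw t)
  have hvc : ContinuousOn v (Ioo a b) :=
    ((hYc.continuousOn.abs.rpow_const fun _ _ => Or.inr hpq.symm.nonneg).const_add 1).inv₀
      fun t _ => (hw t).ne'
  let u : ℝ → ℝ := fun t => (1 + |Y t| ^ q) ^ (-1 / p)
  have hu0 : ∀ t, 0 < u t := fun t => Real.rpow_pos_of_pos (hw t) _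
  have hup : ∀ t, u t ^ p = v t := fun t => by
    simp only [u, v]
    rw [← Real.rpow_mul (hw t).le, div_mul_cancel₀ _ hp.ne', Real.rpow_neg_one]
  have hu1 : ∀ t, u t ≤ 1 := fun t => Real.rpow_le_one_of_one_le_of_nonpos
    (by simp only [le_add_iff_nonneg_right]; positivity)
    (div_nonpos_of_nonpos_of_nonneg (by norm_num) hp.le)
  obtain ⟨c₀, d₀, hac₀, hcd₀, hdb₀, -⟩ := hM 1 one_pos
  have hvI : ∀ {c d}, a < c → d < b → c ≤ d → IntervalIntegrable v volume c d := by
    intro c d hc hd hcd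
    refine (hvc.mono ?_).intervalIntegrable
    rw [uIcc_of_le hcd]
    exact Icc_subset_Ioo hc hd
  have hC : 0 < ∫ t in c₀..d₀, v t :=
    intervalIntegral.intervalIntegral_pos_of_pos (hvI hac₀ hdb₀ hcd₀.le) hv0 hcd₀
  set C := ∫ t in c₀..d₀, v t with hCdef
  have hlam : 0 ≤ (p - 1) * κ ^ p := mul_nonneg hpq.sub_one_pos.le (by positivity)
  set lam := (p - 1) * κ ^ p
  obtain ⟨M, hM0, hMδ⟩ : ∃ M : ℝ, 0 < M ∧ 2 * p * (b - a) * (1 + M ^ q) ^ (-1 / p) <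
      min (C / 2) (ε * (C / 2) / (lam + 1)) := by
    have h1 : Tendsto (fun M : ℝ => 1 + M ^ q) atTop atTop :=
      tendsto_atTop_add_const_left _ _ (tendsto_rpow_atTop hpq.symm.pos)
    have h2 : Tendsto (fun M : ℝ => 2 * p * (b - a) * (1 + M ^ q) ^ (-1 / p)) atTop (𝓝 0) := by
      have := ((tendsto_rpow_neg_atTop (y := 1 / p) (by positivity)).comp h1).const_mul
        (2 * p * (b - a))
      simpa [Function.comp_def, neg_div] using this
    have h3 : 0 < min (C / 2) (ε * (C / 2) / (lam + 1)) := by positivity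
    obtain ⟨M, hM1, hM2⟩ := ((h2.eventually (gt_mem_nhds h3)).and (eventually_gt_atTop 0)).exists
    exact ⟨M, hM2, hM1⟩
  obtain ⟨c, d, hac, hcd, hdb, hYc0, hYd0, hout⟩ := hM M hM0
  have hδ : 0 < (1 + M ^ q) ^ (-1 / p) := by positivity
  set δ := (1 + M ^ q) ^ (-1 / p) with hδdef
  obtain ⟨ψ, η, hη, hψ, hη01, hψ0, hψs⟩ := exists_softThreshold hδ
  have huδ : ∀ t ∈ Ioo a b, t ∉ Icc c d → u t ≤ δ := by
    intro t ht htcd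
    refine Real.rpow_le_rpow_of_nonpos (by positivity) ?_
      (div_nonpos_of_nonpos_of_nonneg (by norm_num) hp.le)
    have := Real.rpow_le_rpow hM0.le (hout t ht htcd).le hpq.symm.nonneg
    linarith
  let g : ℝ → ℝ := fun t => if t ∈ Icc c d then ψ (u t) else 0
  have hg0 : ∀ t ∉ Icc c d, g t = 0 := fun t ht => if_neg ht
  have hgu : ∀ t ∈ Ioo a b, g t = ψ (u t) := by
    intro t ht
    by_cases h : t ∈ Icc c d
    · exact if_pos h
    · rw [hg0 t h, hψ0 _ (huδ t ht h)]
  have hψu : ∀ t, 0 ≤ ψ (u t) ∧ ψ (u t) ≤ u t ∧ u t - ψ (u t) ≤ 2 * δ := fun t => hψs _ (hu0 t).le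
  have hgd : ∀ t ∈ Ioo a b, HasDerivAt g (η (u t) *
      (-κ * (|Y t| ^ (q - 2) * Y t * (1 + |Y t| ^ q) ^ (-1 / p)))) t := by
    intro t ht
    refine ((hψ (u t)).comp t (hasDerivAt_riccati_profile hpq (hY t ht))).congr_of_eventuallyEq ?_
    filter_upwards [isOpen_Ioo.mem_nhds ht] with s hs using hgu s hs
  have hψC : ContDiff ℝ 1 ψ := by
    rw [contDiff_one_iff_deriv]
    refine ⟨fun s => (hψ s).differentiableAt, ?_⟩
    rwa [show deriv ψ = η from funext fun s => (hψ s).deriv]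
  have huC : ContDiffOn ℝ 1 u (Ioo a b) := by
    have h1 : ContDiffOn ℝ 1 (fun t => |Y t| ^ q) (Ioo a b) :=
      (contDiff_norm_rpow (E := ℝ) hpq.symm.lt).comp_contDiffOn hYc
    exact (contDiffOn_const.add h1).rpow_const_of_ne fun t _ => (hw t).ne'
  have hgC : ContDiff ℝ 1 g := by
    rw [contDiff_iff_contDiffAt]
    intro t
    by_cases ht : t ∈ Ioo a b
    · refine ((hψC.comp_contDiffOn huC).contDiffAt (isOpen_Ioo.mem_nhds ht)).congr_of_eventuallyEq ?_
      filter_upwards [isOpen_Ioo.mem_nhds ht] with s hs using hgu s hs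
    · have ht' : t ∉ Icc c d := fun h => ht (Icc_subset_Ioo hac hdb h)
      refine (contDiffAt_const (c := (0 : ℝ))).congr_of_eventuallyEq ?_
      filter_upwards [isClosed_Icc.isOpen_compl.mem_nhds ht'] with s hs using hg0 s hs
  have hg'0 : ∀ t ∉ Icc c d, deriv g t = 0 := by
    intro t ht
    have : g =ᶠ[𝓝 t] fun _ => 0 := by
      filter_upwards [isClosed_Icc.isOpen_compl.mem_nhds ht] with s hs using hg0 s hs
    rw [this.deriv_eq, deriv_const]
  have hIcont : ∀ f : ℝ → ℝ, Continuous f → ∀ x y, IntervalIntegrable (fun t => |f t| ^ p)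
      volume x y := fun f hf x y =>
    (hf.abs.rpow_const fun _ => Or.inr hp.le).intervalIntegrable x y
  have hgp : ∀ t ∈ Ioo a b, v t - 2 * p * δ ≤ |g t| ^ p := by
    intro t ht
    obtain ⟨h1, h2, h3⟩ := hψu t
    have := rpow_sub_rpow_le hpq.lt.le h1 h2 (hu1 t)
    rw [hup] at this
    rw [hgu t ht, abs_of_nonneg h1]
    nlinarith
  have hlow : ∀ {x y}, a < x → y < b → x ≤ y →
      (∫ t in x..y, v t) - 2 * p * (b - a) * δ ≤ ∫ t in x..y, |g t| ^ p := by
    intro x y hx hy hxy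
    have h1 := intervalIntegral.integral_mono_on hxy
      ((hvI hx hy hxy).sub (intervalIntegrable_const (c := 2 * p * δ)))
      (hIcont g hgC.continuous x y) fun t ht => hgp t (Icc_subset_Ioo hx hy ht)
    rw [intervalIntegral.integral_sub (hvI hx hy hxy) intervalIntegrable_const,
      intervalIntegral.integral_const, smul_eq_mul] at h1
    have h2 : (y - x) * (2 * p * δ) ≤ (b - a) * (2 * p * δ) :=
      mul_le_mul_of_nonneg_right (by linarith) (by positivity)
    linarith
  have hint := integral_abs_rpow_eq_intervalIntegral hp hcd.le hg0
  have hCle : C - 2 * p * (b - a) * δ ≤ ∫ t, |g t| ^ p := by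
    refine (hlow hac₀ hdb₀ hcd₀.le).trans ?_
    rw [intervalIntegral.integral_of_le hcd₀.le]
    refine setIntegral_le_integral ?_ (Eventually.of_forall fun t => by positivity)
    refine Continuous.integrable_of_hasCompactSupport
      (hgC.continuous.abs.rpow_const fun _ => Or.inr hp.le) ?_
    refine HasCompactSupport.intro (isCompact_Icc (a := c) (b := d)) fun t ht => ?_
    rw [hg0 t ht, abs_zero, Real.zero_rpow hp.ne']
  have hδ1 := hMδ.trans_le (min_le_left _ _)
  have hδ2 := hMδ.trans_le (min_le_right _ _)
  rw [lt_div_iff₀ (by positivity)] at hδ2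
  refine ⟨g, hgC, ⟨c, d, hac, hcd, hdb, hg0⟩, by linarith, ?_⟩
  have henergy : ∫ t, |deriv g t| ^ p ≤ lam * ∫ t in c..d, v t := by
    rw [integral_abs_rpow_eq_intervalIntegral hp hcd.le hg'0]
    refine le_trans ?_ (integral_riccati_profile_le hpq hκ hcd.le
      (fun t ht => hY t (Icc_subset_Ioo hac hdb ht)) (by linarith) (by linarith))
    have hYcd : ContinuousOn (fun t => |Y t| ^ q) (Icc c d) :=
      (hYc.continuousOn.mono (Icc_subset_Ioo hac hdb)).abs.rpow_const
        fun _ _ => Or.inr hpq.symm.nonneg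
    have hvcd := hvc.mono (Icc_subset_Ioo hac hdb)
    refine intervalIntegral.integral_mono_on hcd.le
      (hIcont _ (hgC.continuous_deriv le_rfl) c d) ?_ fun t ht => ?_
    · rw [← uIcc_of_le hcd.le] at hYcd hvcd
      exact (hYcd.mul hvcd).intervalIntegrable.const_mul _
    · rw [(hgd t (Icc_subset_Ioo hac hdb ht)).deriv, ← abs_riccati_profile_deriv_rpow hpq hκ (Y t)]
      refine Real.rpow_le_rpow (abs_nonneg _) ?_ hp.le
      rw [abs_mul, abs_of_nonneg (hη01 _).1]
      exact mul_le_of_le_one_left (abs_nonneg _) (hη01 _).2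
  have h1 := hlow hac hdb hcd.le
  rw [← hint] at h1
  have h2 := mul_le_mul_of_nonneg_left h1 hlam
  have h3 : ε * (C / 2) < ε * ∫ t, |g t| ^ p := mul_lt_mul_of_pos_left (by linarith) hε
  have h4 : 0 ≤ 2 * p * (b - a) * δ := by
    have := sub_pos.2 hab
    positivity
  linarith

theorem exists_contDiff_near_extremal (hpq : p.HolderConjugate q) {a b ε : ℝ} (hab : a < b)
    (hε : 0 < ε) :
    ∃ f : ℝ → ℝ, ContDiff ℝ (⊤ : ℕ∞) f ∧ HasCompactSupport f ∧ tsupport f ⊆ Ioo a b ∧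
      0 < ∫ t, |f t| ^ p ∧
      ∫ t, |deriv f t| ^ p ≤ ((p - 1) * (piP p / (b - a)) ^ p + ε) * ∫ t, |f t| ^ p := by
  have hp := hpq.pos
  obtain ⟨g, hg, ⟨c, d, hac, hcd, hdb, hg0⟩, hpos, hlt⟩ :=
    exists_contDiff_one_near_extremal hpq hab hε
  obtain ⟨δ, hδ, hδc, hδd⟩ : ∃ δ, 0 < δ ∧ a < c - δ ∧ d + δ < b := by
    refine ⟨min (c - a) (b - d) / 2, ?_, ?_, ?_⟩
    · have := lt_min (sub_pos.2 hac) (sub_pos.2 hdb)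
      positivity
    · linarith [min_le_left (c - a) (b - d)]
    · linarith [min_le_right (c - a) (b - d)]
  let φ : ℕ → ContDiffBump (0 : ℝ) := fun n =>
    ⟨δ / (n + 1) / 2, δ / (n + 1), by positivity, half_lt_self (by positivity)⟩
  have hφδ : ∀ n, (φ n).rOut ≤ δ := fun n => div_le_self hδ.le (by simp)
  have hφ0 : Tendsto (fun n => (φ n).rOut) atTop (𝓝 0) := by
    simpa [φ, div_eq_mul_inv] using (tendsto_one_div_add_atTop_nhds_zero_nat (𝕜 := ℝ)).const_mul δ
  let mol : (ℝ → ℝ) → ℕ → ℝ → ℝ := fun h n =>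
    convolution ((φ n).normed volume) h (ContinuousLinearMap.lsmul ℝ ℝ) volume
  have hg'0 : ∀ t ∉ Icc c d, deriv g t = 0 := by
    intro t ht
    have : g =ᶠ[𝓝 t] fun _ => 0 := by
      filter_upwards [isClosed_Icc.isOpen_compl.mem_nhds ht] with s hs using hg0 s hs
    rw [this.deriv_eq, deriv_const]
  have hmol0 : ∀ h : ℝ → ℝ, Continuous h → (∀ t ∉ Icc c d, h t = 0) →
      ∀ n, ∀ t ∉ Icc (c - δ) (d + δ), mol h n t = 0 := by
    intro h hh h0 n t ht
    have hball : ∀ s ∈ Metric.ball t (φ n).rOut, s ∉ Icc c d := by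
      intro s hs hs'
      have h1 := hs.trans_le (hφδ n)
      rw [Real.dist_eq, abs_lt] at h1
      exact ht ⟨by linarith [hs'.1], by linarith [hs'.2]⟩
    have ht0 : h t = 0 := h0 t (hball t (Metric.mem_ball_self (φ n).rOut_pos))
    have := ContDiffBump.dist_normed_convolution_le (φ := φ n) (μ := volume) (g := h) (x₀ := t)
      (ε := 0) hh.aestronglyMeasurable fun s hs => by rw [h0 s (hball s hs), ht0, dist_self]
    rw [ht0] at this
    exact dist_le_zero.1 this
  have hmolc : ∀ h : ℝ → ℝ, Continuous h → ∀ n, ContDiff ℝ (⊤ : ℕ∞) (mol h n) := fun h hh n =>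
    (φ n).hasCompactSupport_normed.contDiff_convolution_left _ (φ n).contDiff_normed
      hh.locallyIntegrable
  have hconv : ∀ h : ℝ → ℝ, Continuous h → (∀ t ∉ Icc c d, h t = 0) →
      Tendsto (fun n => ∫ t, |mol h n t| ^ p) atTop (𝓝 (∫ t, |h t| ^ p)) := by
    intro h hh h0
    obtain ⟨K, hK⟩ := (HasCompactSupport.intro isCompact_Icc h0).exists_bound_of_continuous hh
    have hbd : ∀ n t, |mol h n t| ≤ 3 * K := by
      intro n t
      have h1 := ContDiffBump.dist_normed_convolution_le (φ := φ n) (μ := volume) (g := h)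
        (x₀ := t) (ε := K + K) hh.aestronglyMeasurable fun s _ =>
          (dist_le_norm_add_norm _ _).trans (add_le_add (hK s) (hK t))
      rw [Real.dist_eq] at h1
      have h2 := abs_sub_abs_le_abs_sub (mol h n t) (h t)
      have h3 := hK t
      rw [Real.norm_eq_abs] at h3
      have h4 : |mol h n t - h t| ≤ K + K := h1
      linarith
    refine tendsto_integral_of_dominated_convergence
      ((Icc (c - δ) (d + δ)).indicator fun _ => (3 * K) ^ p) (fun n => ?_) ?_ (fun n => ?_) ?_
    · exact ((hmolc h hh n).continuous.abs.rpow_const fun _ => Or.inr hp.le).aestronglyMeasurable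
    · exact (integrable_indicator_iff measurableSet_Icc).2 (by simp [integrableOn_const_iff])
    · refine Eventually.of_forall fun t => ?_
      rw [Real.norm_of_nonneg (by positivity)]
      by_cases ht : t ∈ Icc (c - δ) (d + δ)
      · rw [indicator_of_mem ht]
        exact Real.rpow_le_rpow (abs_nonneg _) (hbd n t) hp.le
      · rw [indicator_of_notMem ht, hmol0 h hh h0 n t ht, abs_zero, Real.zero_rpow hp.ne']
    · refine Eventually.of_forall fun t => ?_
      exact ((ContDiffBump.convolution_tendsto_right_of_continuous hφ0 hh t).abs).rpow_const
        (Or.inr hp.le)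
  have hgc : HasCompactSupport g := HasCompactSupport.intro isCompact_Icc hg0
  have hderiv : ∀ n, deriv (mol g n) = mol (deriv g) n := fun n => funext fun t =>
    (hgc.hasDerivAt_convolution_right _
      (φ n).continuous_normed.locallyIntegrable hg t).deriv
  have h1 := hconv g hg.continuous hg0
  have h2 := hconv (deriv g) (hg.continuous_deriv le_rfl) hg'0
  obtain ⟨n, hn1, hn2⟩ := ((h1.eventually (lt_mem_nhds hpos)).and
    (h2.eventually_lt (h1.const_mul _) hlt)).exists
  have h0 := hmol0 g hg.continuous hg0 n
  refine ⟨mol g n, hmolc g hg.continuous n, HasCompactSupport.intro isCompact_Icc h0, ?_, hn1, ?_⟩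
  · refine (closure_minimal ?_ isClosed_Icc).trans (Icc_subset_Ioo hδc hδd)
    exact fun t ht => by_contra fun h => ht (h0 t h)
  · rw [hderiv]
    exact hn2.le

end NearExtremalSmooth

section ProductTestFunctions

variable {p q : ℝ} {n : ℕ}

theorem isTestFun_prod {D : Set (Fin n → ℝ)} {f : Fin n → ℝ → ℝ}
    (hf : ∀ i, ContDiff ℝ (⊤ : ℕ∞) (f i)) (hc : ∀ i, HasCompactSupport (f i))
    (hD : univ.pi (fun i => tsupport (f i)) ⊆ D) : IsTestFun D fun x => ∏ i, f i (x i) := by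
  have hsub : Function.support (fun x : Fin n → ℝ => ∏ i, f i (x i)) ⊆
      univ.pi fun i => tsupport (f i) := fun x hx i _ =>
    subset_tsupport _ (Finset.prod_ne_zero_iff.1 hx i (Finset.mem_univ i))
  refine ⟨contDiff_prod fun i _ => (hf i).comp (contDiff_apply ℝ ℝ i), ?_, ?_⟩
  · refine HasCompactSupport.intro (isCompact_univ_pi fun i => (hc i).isCompact) fun x hx => ?_
    exact by_contra fun h => hx (hsub h)
  · exact (closure_minimal hsub (isClosed_set_pi fun i _ => isClosed_tsupport _)).trans hD

theorem pder_prod {f : Fin n → ℝ → ℝ} (hf : ∀ i, Differentiable ℝ (f i)) (i : Fin n)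
    (x : Fin n → ℝ) :
    pder i (fun x => ∏ j, f j (x j)) x = ∏ j, Function.update f i (deriv (f i)) j (x j) := by
  have h1 : ∀ j ∈ (Finset.univ : Finset (Fin n)), HasFDerivAt (fun x : Fin n → ℝ => f j (x j))
      (deriv (f j) (x j) • ContinuousLinearMap.proj (R := ℝ) (φ := fun _ : Fin n => ℝ) j) x :=
    fun j _ => (hf j (x j)).hasDerivAt.comp_hasFDerivAt x (hasFDerivAt_apply j x)
  rw [pder, (HasFDerivAt.finsetProd h1).fderiv, _root_.sum_apply,
    Finset.sum_eq_single i]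
  · rw [← Finset.prod_erase_mul _ _ (Finset.mem_univ i)]
    simp only [_root_.smul_apply, ContinuousLinearMap.proj_apply, Pi.single_eq_same,
      smul_eq_mul, mul_one, Function.update_self]
    congr 1
    refine Finset.prod_congr rfl fun j hj => ?_
    rw [Function.update_of_ne (Finset.ne_of_mem_erase hj)]
  · intro j _ hj
    simp [hj]
  · simp

theorem integral_abs_prod_rpow (f : Fin n → ℝ → ℝ) :
    ∫ x : Fin n → ℝ, |∏ i, f i (x i)| ^ p = ∏ i, ∫ t, |f i t| ^ p := by
  rw [← integral_fintype_prod_volume_eq_prod]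
  congr 1
  ext x
  rw [Finset.abs_prod, Real.finsetProd_rpow _ _ fun i _ => abs_nonneg _]

theorem exists_isTestFun_near_extremal (hpq : p.HolderConjugate q) {a b : Fin n → ℝ}
    (hab : ∀ i, a i < b i) {ε : ℝ} (hε : 0 < ε) :
    ∃ u, IsTestFun (univ.pi fun i => Ioo (a i) (b i)) u ∧ 0 < ∫ x, |u x| ^ p ∧
      ∑ i, ∫ x, |pder i u x| ^ p ≤
        (∑ i, ((p - 1) * (piP p / (b i - a i)) ^ p + ε)) * ∫ x, |u x| ^ p := by
  choose f hf hfc hfs hpos hle using fun i => exists_contDiff_near_extremal hpq (hab i) hε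
  refine ⟨fun x => ∏ i, f i (x i), isTestFun_prod hf hfc (pi_mono fun i _ => hfs i), ?_, ?_⟩
  · rw [integral_abs_prod_rpow]
    exact Finset.prod_pos fun i _ => hpos i
  · rw [Finset.sum_mul]
    refine Finset.sum_le_sum fun i _ => ?_
    simp_rw [pder_prod (fun i => (hf i).differentiable (by simp)) i]
    rw [integral_abs_prod_rpow, integral_abs_prod_rpow,
      ← Finset.mul_prod_erase _ _ (Finset.mem_univ i),
      ← Finset.mul_prod_erase _ (fun i => ∫ t, |f i t| ^ p) (Finset.mem_univ i), ← mul_assoc,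
      Function.update_self]
    have h : ∏ j ∈ Finset.univ.erase i, ∫ t, |Function.update f i (deriv (f i)) j t| ^ p =
        ∏ j ∈ Finset.univ.erase i, ∫ t, |f j t| ^ p :=
      Finset.prod_congr rfl fun j hj => by rw [Function.update_of_ne (Finset.ne_of_mem_erase hj)]
    rw [h]
    exact mul_le_mul_of_nonneg_right (hle i) (Finset.prod_nonneg fun j _ => (hpos j).le)

/-- Arbitrarily many near-extremal test functions in the strip, separated along a free direction. -/
theorem exists_isTestFun_family (hpq : p.HolderConjugate q) {k : ℕ} {a b : Fin n → ℝ}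
    (hab : ∀ i : Fin n, k ≤ (i : ℕ) → a i < b i) (i₀ : Fin n) (hi₀ : (i₀ : ℕ) < k)
    {ε : ℝ} (hε : 0 < ε) :
    ∃ R : ℝ, 0 < R ∧ ∀ j : ℕ, ∃ u,
      IsTestFun (stripDomain n k a b ∩ {x | x i₀ ∈ Ioo (j * R) ((j + 1) * R)}) u ∧
      0 < ∫ x, |u x| ^ p ∧
      ∑ i, ∫ x, |pder i u x| ^ p ≤
        ((∑ i ∈ Finset.univ.filter (fun i : Fin n => k ≤ (i : ℕ)),
          (p - 1) * (piP p / (b i - a i)) ^ p) + ε) * ∫ x, |u x| ^ p := by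
  have hn : 0 < (n : ℝ) := Nat.cast_pos.2 i₀.pos
  have hη : 0 < ε / (2 * n) := by positivity
  set η := ε / (2 * n) with hηdef
  obtain ⟨R, hR0, hR⟩ : ∃ R : ℝ, 0 < R ∧ (p - 1) * (piP p / R) ^ p < η := by
    have h1 : Tendsto (fun R : ℝ => (p - 1) * (piP p / R) ^ p) atTop (𝓝 0) := by
      have := ((tendsto_const_nhds (x := piP p)).div_atTop tendsto_id).rpow_const
        (p := p) (Or.inr hpq.nonneg)
      simpa [Real.zero_rpow hpq.pos.ne'] using this.const_mul (p - 1)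
    obtain ⟨R, h2, h3⟩ := ((h1.eventually (gt_mem_nhds hη)).and (eventually_gt_atTop 0)).exists
    exact ⟨R, h3, h2⟩
  refine ⟨R, hR0, fun j => ?_⟩
  let a' : Fin n → ℝ := fun i => if k ≤ (i : ℕ) then a i else j * R
  let b' : Fin n → ℝ := fun i => if k ≤ (i : ℕ) then b i else (j + 1) * R
  have hab' : ∀ i, a' i < b' i := by
    intro i
    by_cases h : k ≤ (i : ℕ)
    · simpa [a', b', h] using hab i h
    · simp only [a', b', h, if_false]
      linarith
  obtain ⟨u, hu, hpos, hle⟩ := exists_isTestFun_near_extremal hpq hab' hη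
  refine ⟨u, ⟨hu.1, hu.2.1, hu.2.2.trans fun x hx => ⟨fun i hi => ?_, ?_⟩⟩, hpos, hle.trans ?_⟩
  · simpa [a', b', hi] using hx i (mem_univ i)
  · simpa [a', b', hi₀.not_ge] using hx i₀ (mem_univ i₀)
  · refine mul_le_mul_of_nonneg_right ?_ hpos.le
    have h1 : ∀ i : Fin n, (p - 1) * (piP p / (b' i - a' i)) ^ p + η ≤
        (if k ≤ (i : ℕ) then (p - 1) * (piP p / (b i - a i)) ^ p else 0) + 2 * η := by
      intro i
      by_cases h : k ≤ (i : ℕ)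
      · simp only [a', b', h, if_true]
        linarith
      · simp only [a', b', h, if_false]
        rw [show ((j : ℝ) + 1) * R - j * R = R by ring]
        linarith
    refine (Finset.sum_le_sum fun i _ => h1 i).trans (le_of_eq ?_)
    rw [Finset.sum_add_distrib, ← Finset.sum_filter, Finset.sum_const, Finset.card_univ,
      Fintype.card_fin, nsmul_eq_mul, hηdef]
    field_simp

end ProductTestFunctions

section DisjointSupports

variable {α : Type} [MeasurableSpace α] {μ : Measure α} {E F : Type} [NormedAddCommGroup E]
  [NormedAddCommGroup F] {P : ℝ≥0∞} [hP1 : Fact (1 ≤ P)]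

theorem Lp_norm_rpow_eq_integral (hP : P ≠ ∞) (f : Lp E P μ) :
    ‖f‖ ^ P.toReal = ∫ x, ‖f x‖ ^ P.toReal ∂μ := by
  have h0 : P ≠ 0 := (zero_lt_one.trans_le hP1.out).ne'
  have hnn : 0 ≤ ∫ x, ‖f x‖ ^ P.toReal ∂μ := integral_nonneg fun x => by positivity
  rw [Lp.norm_def, (Lp.memLp f).eLpNorm_eq_integral_rpow_norm h0 hP,
    ENNReal.toReal_ofReal (by positivity), Real.rpow_inv_rpow hnn (ENNReal.toReal_ne_zero.2 ⟨h0, hP⟩)]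

theorem Lp_integrable_norm_rpow (hP : P ≠ ∞) (f : Lp E P μ) :
    Integrable (fun x => ‖f x‖ ^ P.toReal) μ :=
  (Lp.memLp f).integrable_norm_rpow (zero_lt_one.trans_le hP1.out).ne' hP

theorem PiLp_norm_rpow_eq_sum (hP : P ≠ ∞) {ι : Type*} [Fintype ι] (g : PiLp P fun _ : ι => ℝ) :
    ‖g‖ ^ P.toReal = ∑ j, |g j| ^ P.toReal := by
  have h0 := ENNReal.toReal_pos (zero_lt_one.trans_le hP1.out).ne' hP
  rw [PiLp.norm_eq_sum h0, one_div, Real.rpow_inv_rpow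
    (Finset.sum_nonneg fun j _ => by positivity) h0.ne']
  rfl

variable [NormedSpace ℝ E] [NormedSpace ℝ F]

theorem Lp_norm_sum_rpow_le (hP : P ≠ ∞) {N : ℕ} {S : Fin N → Set α}
    (hS : Pairwise (Function.onFun Disjoint S)) {f : Fin N → Lp E P μ}
    (hf : ∀ j, ∀ᵐ x ∂μ, x ∉ S j → f j x = 0) (c : Fin N → ℝ) :
    ‖∑ j, c j • f j‖ ^ P.toReal ≤ ∑ j, (|c j| * ‖f j‖) ^ P.toReal := by
  have h0 := ENNReal.toReal_pos (zero_lt_one.trans_le hP1.out).ne' hP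
  have h1 : ∀ᵐ x ∂μ, ‖(∑ j, c j • f j : Lp E P μ) x‖ ^ P.toReal ≤
      ∑ j, |c j| ^ P.toReal * ‖f j x‖ ^ P.toReal := by
    filter_upwards [Lp.coeFn_finsetSum Finset.univ fun j => c j • f j,
      ae_all_iff.2 fun j => Lp.coeFn_smul (c j) (f j), ae_all_iff.2 hf] with x hx1 hx2 hx3
    rw [hx1, Finset.sum_apply]
    simp only [hx2, Pi.smul_apply]
    have hnn : ∀ j, 0 ≤ |c j| ^ P.toReal * ‖f j x‖ ^ P.toReal := fun j => by positivity
    by_cases hx : ∃ j, x ∈ S j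
    · obtain ⟨j, hj⟩ := hx
      rw [Finset.sum_eq_single j]
      · rw [norm_smul, Real.norm_eq_abs, Real.mul_rpow (abs_nonneg _) (norm_nonneg _)]
        exact Finset.single_le_sum (f := fun j => |c j| ^ P.toReal * ‖f j x‖ ^ P.toReal)
          (fun j _ => hnn j) (Finset.mem_univ j)
      · intro i _ hij
        rw [hx3 i fun hi => (Set.disjoint_left.1 (hS hij) hi hj).elim, smul_zero]
      · simp
    · rw [Finset.sum_eq_zero fun j _ => by rw [hx3 j fun hj => hx ⟨j, hj⟩, smul_zero], norm_zero,
        Real.zero_rpow h0.ne']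
      exact Finset.sum_nonneg fun j _ => hnn j
  have hI : ∀ j, Integrable (fun x => |c j| ^ P.toReal * ‖f j x‖ ^ P.toReal) μ := fun j =>
    (Lp_integrable_norm_rpow hP (f j)).const_mul _
  rw [Lp_norm_rpow_eq_integral hP]
  refine (integral_mono_ae (Lp_integrable_norm_rpow hP _)
    (integrable_finsetSum _ fun j _ => hI j) h1).trans (le_of_eq ?_)
  rw [integral_finsetSum _ fun j _ => hI j]
  refine Finset.sum_congr rfl fun j _ => ?_
  rw [integral_const_mul, ← Lp_norm_rpow_eq_integral hP,
    Real.mul_rpow (abs_nonneg _) (norm_nonneg _)]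

theorem LpToLpRestrictCLM_norm_rpow (hP : P ≠ ∞) (S : Set α) (f : Lp E P μ) :
    ‖LpToLpRestrictCLM α E ℝ μ P S f‖ ^ P.toReal = ∫ x in S, ‖f x‖ ^ P.toReal ∂μ := by
  rw [Lp_norm_rpow_eq_integral hP]
  refine integral_congr_ae ?_
  filter_upwards [LpToLpRestrictCLM_coeFn ℝ S f] with x hx
  rw [hx]

theorem sum_LpToLpRestrictCLM_norm_rpow_le (hP : P ≠ ∞) {N : ℕ} {S : Fin N → Set α}
    (hSm : ∀ j, MeasurableSet (S j)) (hS : Pairwise (Function.onFun Disjoint S)) (f : Lp E P μ) :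
    ∑ j, ‖LpToLpRestrictCLM α E ℝ μ P (S j) f‖ ^ P.toReal ≤ ‖f‖ ^ P.toReal := by
  simp_rw [LpToLpRestrictCLM_norm_rpow hP]
  have hI := Lp_integrable_norm_rpow hP f
  rw [← integral_iUnion_fintype hSm hS fun j => hI.integrableOn, Lp_norm_rpow_eq_integral hP]
  exact setIntegral_le_integral hI (Eventually.of_forall fun x => by positivity)

theorem LpToLpRestrictCLM_norm_of_ae_eq_zero (hP : P ≠ ∞) {S : Set α} {f : Lp E P μ}
    (hf : ∀ᵐ x ∂μ, x ∉ S → f x = 0) :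
    ‖LpToLpRestrictCLM α E ℝ μ P S f‖ = ‖f‖ := by
  have h0 := ENNReal.toReal_pos (zero_lt_one.trans_le hP1.out).ne' hP
  rw [← Real.rpow_left_inj (norm_nonneg _) (norm_nonneg _) h0.ne', LpToLpRestrictCLM_norm_rpow hP,
    Lp_norm_rpow_eq_integral hP]
  refine setIntegral_eq_integral_of_ae_compl_eq_zero ?_
  filter_upwards [hf] with x hx hxS
  rw [hx hxS, norm_zero, Real.zero_rpow h0.ne']

theorem LpToLpRestrictCLM_eq_zero {S S' : Set α} (hSm : MeasurableSet S) (hd : Disjoint S S')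
    {f : Lp E P μ} (hf : ∀ᵐ x ∂μ, x ∉ S' → f x = 0) :
    LpToLpRestrictCLM α E ℝ μ P S f = 0 := by
  rw [Lp.eq_zero_iff_ae_eq_zero]
  filter_upwards [LpToLpRestrictCLM_coeFn ℝ S f, ae_restrict_of_ae hf, ae_restrict_mem hSm]
    with x h1 h2 h3
  rw [h1, h2 (Set.disjoint_left.1 hd h3)]
  rfl

/-- Disjointly supported near-maximizers of `T` produce a factorization of the identity
of `ℓ^p_N` through `T`. -/
theorem factorsIdentity_of_disjoint (hP : P ≠ ∞) {W : Submodule ℝ (Lp E P μ)}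
    (T : W →L[ℝ] Lp F P μ) {r : ℝ} (hr : 0 < r) {N : ℕ} {S : Fin N → Set α}
    (hSm : ∀ j, MeasurableSet (S j)) (hS : Pairwise (Function.onFun Disjoint S)) (w : Fin N → W)
    (hw : ∀ j, ∀ᵐ x ∂μ, x ∉ S j → (w j : Lp E P μ) x = 0)
    (hTw : ∀ j, ∀ᵐ x ∂μ, x ∉ S j → T (w j) x = 0) (hpos : ∀ j, 0 < ‖w j‖)
    (hle : ∀ j, r * ‖w j‖ ≤ ‖T (w j)‖) : FactorsIdentity P T r N := by
  have h0 := ENNReal.toReal_pos (zero_lt_one.trans_le hP1.out).ne' hP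
  have hTpos : ∀ j, 0 < ‖T (w j)‖ := fun j => (mul_pos hr (hpos j)).trans_le (hle j)
  let ρ := fun j => LpToLpRestrictCLM α F ℝ μ P (S j)
  choose φ hφ1 hφ2 using fun j => exists_dual_vector'' ℝ (ρ j (T (w j)))
  let A₀ : Lp F P μ →L[ℝ] Fin N → ℝ :=
    ContinuousLinearMap.pi fun j => (‖w j‖ / ‖T (w j)‖) • (φ j).comp (ρ j)
  let A : Lp F P μ →L[ℝ] PiLp P (fun _ : Fin N => ℝ) :=
    ((PiLp.continuousLinearEquiv P ℝ fun _ : Fin N => ℝ).symm : _ →L[ℝ] _).comp A₀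
  have hA : ∀ y j, A y j = ‖w j‖ / ‖T (w j)‖ * φ j (ρ j y) := fun y j => rfl
  let B : PiLp P (fun _ : Fin N => ℝ) →L[ℝ] W :=
    ∑ j, (PiLp.proj P (𝕜 := ℝ) (fun _ : Fin N => ℝ) j).smulRight (‖w j‖⁻¹ • w j)
  have hB : ∀ g, B g = ∑ j, (g j * ‖w j‖⁻¹) • w j := fun g => by
    simp [B, _root_.sum_apply, smul_smul]
  have hAw : ∀ i j, A (T (w i)) j = if i = j then ‖w j‖ else 0 := by
    intro i j
    rw [hA]
    split_ifs with h
    · subst h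
      rw [hφ2, LpToLpRestrictCLM_norm_of_ae_eq_zero hP (hTw i)]
      exact div_mul_cancel₀ _ (hTpos i).ne'
    · rw [show ρ j (T (w i)) = 0 from
        LpToLpRestrictCLM_eq_zero (hSm j) (hS (Ne.symm h)) (hTw i), map_zero, mul_zero]
  refine ⟨A, B, fun g => ?_, fun y => ?_, fun g => ?_⟩
  · ext j
    simp only [hB, map_sum, map_smul, WithLp.ofLp_sum, WithLp.ofLp_smul, Finset.sum_apply,
      Pi.smul_apply, hAw, smul_eq_mul]
    rw [Finset.sum_eq_single j]
    · rw [if_pos rfl, mul_assoc, inv_mul_cancel₀ (hpos j).ne', mul_one]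
    · intro i _ hij
      rw [if_neg hij, mul_zero]
    · simp
  · rw [← Real.rpow_le_rpow_iff (by positivity) (norm_nonneg _) h0,
      Real.mul_rpow hr.le (norm_nonneg _), PiLp_norm_rpow_eq_sum hP, Finset.mul_sum]
    refine (Finset.sum_le_sum fun j _ => ?_).trans (sum_LpToLpRestrictCLM_norm_rpow_le hP hSm hS y)
    rw [← Real.mul_rpow hr.le (abs_nonneg _)]
    refine Real.rpow_le_rpow (by positivity) ?_ h0.le
    have h1 : |φ j (ρ j y)| ≤ ‖ρ j y‖ := by
      refine ((φ j).le_opNorm _).trans ?_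
      exact mul_le_of_le_one_left (norm_nonneg _) (hφ1 j)
    have h2 : r * (‖w j‖ / ‖T (w j)‖) ≤ 1 := by
      rw [← mul_div_assoc, div_le_one (hTpos j)]
      exact hle j
    have h3 : 0 ≤ r * (‖w j‖ / ‖T (w j)‖) := by positivity
    rw [hA, abs_mul, abs_of_nonneg (by positivity : 0 ≤ ‖w j‖ / ‖T (w j)‖), ← mul_assoc]
    exact (mul_le_mul h2 h1 (abs_nonneg _) zero_le_one).trans_eq (one_mul _)
  · rw [← Real.rpow_le_rpow_iff (norm_nonneg _) (norm_nonneg _) h0, PiLp_norm_rpow_eq_sum hP, hB,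
      Submodule.coe_norm]
    simp only [Submodule.coe_sum, Submodule.coe_smul]
    refine (Lp_norm_sum_rpow_le hP hS hw _).trans (le_of_eq ?_)
    refine Finset.sum_congr rfl fun j _ => ?_
    have hne : ‖(w j : Lp E P μ)‖ ≠ 0 := (hpos j).ne'
    rw [abs_mul, abs_inv, abs_norm, Submodule.coe_norm, mul_assoc, inv_mul_cancel₀ hne, mul_one]

end DisjointSupports

section Sobolev

variable {n : ℕ} {D : Set (Fin n → ℝ)} {u v : (Fin n → ℝ) → ℝ} {P : ℝ≥0∞}

theorem IsTestFun.mono {D' : Set (Fin n → ℝ)} (hu : IsTestFun D u) (h : D ⊆ D') :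
    IsTestFun D' u :=
  ⟨hu.1, hu.2.1, hu.2.2.trans h⟩

theorem IsTestFun.zero : IsTestFun D 0 :=
  ⟨contDiff_const, HasCompactSupport.zero, by simp [tsupport]⟩

theorem IsTestFun.add (hu : IsTestFun D u) (hv : IsTestFun D v) : IsTestFun D (u + v) :=
  ⟨hu.1.add hv.1, hu.2.1.add hv.2.1,
    (tsupport_add u v).trans (union_subset hu.2.2 hv.2.2)⟩

theorem IsTestFun.const_smul (hu : IsTestFun D u) (c : ℝ) : IsTestFun D (c • u) :=
  ⟨hu.1.const_smul c, hu.2.1.smul_left (f := fun _ => c),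
    (tsupport_smul_subset_right (fun _ => c) u).trans hu.2.2⟩

theorem IsTestFun.differentiable (hu : IsTestFun D u) : Differentiable ℝ u :=
  hu.1.differentiable (by simp)

theorem IsTestFun.eventuallyEq_zero (hu : IsTestFun D u) {x : Fin n → ℝ} (hx : x ∉ D) :
    u =ᶠ[𝓝 x] 0 :=
  notMem_tsupport_iff_eventuallyEq.1 fun h => hx (hu.2.2 h)

theorem jet_succ (i : Fin n) (x : Fin n → ℝ) : jet P u x i.succ = pder i u x := rfl

theorem jet_add (hu : Differentiable ℝ u) (hv : Differentiable ℝ v) (x : Fin n → ℝ) :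
    jet P (u + v) x = jet P u x + jet P v x := by
  ext i
  refine Fin.cases rfl (fun i => ?_) i
  simp only [PiLp.add_apply, jet_succ, pder, fderiv_add (hu x) (hv x), _root_.add_apply]

theorem jet_const_smul (hu : Differentiable ℝ u) (c : ℝ) (x : Fin n → ℝ) :
    jet P (c • u) x = c • jet P u x := by
  ext i
  refine Fin.cases rfl (fun i => ?_) i
  simp only [PiLp.smul_apply, jet_succ, pder, fderiv_const_smul (hu x), _root_.smul_apply]

theorem jet_eq_zero {x : Fin n → ℝ} (h : u =ᶠ[𝓝 x] 0) : jet P u x = 0 := by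
  ext i
  refine Fin.cases h.self_of_nhds (fun i => ?_) i
  rw [jet_succ, pder, h.fderiv_eq]
  simp

variable [hP1 : Fact (1 ≤ P)]

theorem norm_jet_rpow (hP : P ≠ ∞) (x : Fin n → ℝ) :
    ‖jet P u x‖ ^ P.toReal = |u x| ^ P.toReal + ∑ i, |pder i u x| ^ P.toReal := by
  rw [PiLp_norm_rpow_eq_sum hP, Fin.sum_univ_succ]
  rfl

theorem IsTestFun.memLp_jet (hu : IsTestFun D u) : MemLp (jet P u) P volume := by
  refine Continuous.memLp_of_hasCompactSupport ?_ ?_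
  · refine (PiLp.continuous_toLp P _).comp (continuous_pi fun i => ?_)
    exact Fin.cases hu.1.continuous (fun i => hu.continuous_pder i) i
  · refine HasCompactSupport.intro hu.2.1.isCompact fun x hx => ?_
    exact jet_eq_zero (notMem_tsupport_iff_eventuallyEq.1 hx)

theorem exists_isTestFun_of_mem_span {f : Vsp n P}
    (hf : f ∈ Submodule.span ℝ {f : Vsp n P | ∃ u : (Fin n → ℝ) → ℝ, IsTestFun D u ∧
      (f : (Fin n → ℝ) → PiLp P (fun _ : Fin (n + 1) => ℝ)) =ᵐ[volume] jet P u}) :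
    ∃ u, IsTestFun D u ∧ f =ᵐ[volume] jet P u := by
  induction hf using Submodule.span_induction with
  | mem f hf => exact hf
  | zero =>
    refine ⟨0, IsTestFun.zero, ?_⟩
    filter_upwards [Lp.coeFn_zero (PiLp P (fun _ : Fin (n + 1) => ℝ)) P volume] with x hx
    rw [hx, jet_eq_zero (EventuallyEq.refl _ _)]
    rfl
  | add f g _ _ hf hg =>
    obtain ⟨u, hu, hfu⟩ := hf
    obtain ⟨v, hv, hgv⟩ := hg
    refine ⟨u + v, hu.add hv, ?_⟩
    filter_upwards [Lp.coeFn_add f g, hfu, hgv] with x h1 h2 h3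
    rw [h1, Pi.add_apply, h2, h3, jet_add hu.differentiable hv.differentiable]
  | smul c f _ hf =>
    obtain ⟨u, hu, hfu⟩ := hf
    refine ⟨c • u, hu.const_smul c, ?_⟩
    filter_upwards [Lp.coeFn_smul c f, hfu] with x h1 h2
    rw [h1, Pi.smul_apply, h2, jet_const_smul hu.differentiable]

theorem compLpL_proj0_ae_eq {f : Vsp n P} (hf : f =ᵐ[volume] jet P u) :
    (proj0 n P).compLpL P volume f =ᵐ[volume] u := by
  filter_upwards [ContinuousLinearMap.coeFn_compLpL (p := P) (proj0 n P) f, hf] with x h1 h2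
  rw [h1, h2]
  rfl

theorem norm_compLpL_proj0_rpow (hP : P ≠ ∞) {f : Vsp n P} (hf : f =ᵐ[volume] jet P u) :
    ‖(proj0 n P).compLpL P volume f‖ ^ P.toReal = ∫ x, |u x| ^ P.toReal := by
  rw [Lp_norm_rpow_eq_integral hP]
  refine integral_congr_ae ?_
  filter_upwards [compLpL_proj0_ae_eq hf] with x hx
  rw [hx, Real.norm_eq_abs]

theorem norm_rpow_of_ae_eq_jet (hP : P ≠ ∞) (hu : IsTestFun D u) {f : Vsp n P}
    (hf : f =ᵐ[volume] jet P u) :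
    ‖f‖ ^ P.toReal = (∫ x, |u x| ^ P.toReal) + ∑ i, ∫ x, |pder i u x| ^ P.toReal := by
  have h0 := ENNReal.toReal_pos (zero_lt_one.trans_le hP1.out).ne' hP
  have hI : ∀ i, Integrable fun x => |pder i u x| ^ P.toReal := fun i =>
    integrable_abs_rpow h0 (hu.continuous_pder i) (hu.hasCompactSupport_pder i)
  rw [Lp_norm_rpow_eq_integral hP, ← integral_finsetSum _ fun i _ => hI i,
    ← integral_add (integrable_abs_rpow h0 hu.1.continuous hu.2.1)
      (integrable_finsetSum _ fun i _ => hI i)]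
  refine integral_congr_ae ?_
  filter_upwards [hf] with x hx
  rw [hx, norm_jet_rpow hP]

/-- A Poincaré inequality on test functions bounds the Sobolev embedding. -/
theorem norm_sobolevEmb_le (hP : P ≠ ∞) {Λ : ℝ} (hΛ : 0 ≤ Λ)
    (h : ∀ u, IsTestFun D u →
      Λ * ∫ x, |u x| ^ P.toReal ≤ ∑ i, ∫ x, |pder i u x| ^ P.toReal) :
    ‖SobolevEmb P D‖ ≤ (1 + Λ) ^ (-1 / P.toReal) := by
  have h0 := ENNReal.toReal_pos (zero_lt_one.trans_le hP1.out).ne' hP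
  have hτ : 0 ≤ (1 + Λ) ^ (-1 / P.toReal) := by positivity
  refine ContinuousLinearMap.opNorm_le_bound _ hτ fun x => ?_
  have hcl : IsClosed {f : Vsp n P | ‖(proj0 n P).compLpL P volume f‖ ≤
      (1 + Λ) ^ (-1 / P.toReal) * ‖f‖} :=
    isClosed_le (by fun_prop) (by fun_prop)
  refine closure_minimal (fun f hf => ?_) hcl x.2
  obtain ⟨u, hu, hfu⟩ := exists_isTestFun_of_mem_span hf
  rw [mem_ofPred_eq, ← Real.rpow_le_rpow_iff (norm_nonneg _) (by positivity) h0,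
    Real.mul_rpow hτ (norm_nonneg _), ← Real.rpow_mul (by positivity),
    div_mul_cancel₀ _ h0.ne', norm_compLpL_proj0_rpow hP hfu, norm_rpow_of_ae_eq_jet hP hu hfu,
    Real.rpow_neg_one, ← div_eq_inv_mul, le_div_iff₀ (by positivity)]
  linarith [h u hu]

/-- Disjointly supported test functions with Rayleigh quotient at most `r ^ (-p)` make the
Sobolev embedding factor the identity. -/
theorem factorsIdentity_sobolevEmb (hP : P ≠ ∞) {r : ℝ} (hr : 0 < r) {N : ℕ}
    {S : Fin N → Set (Fin n → ℝ)} (hSm : ∀ j, MeasurableSet (S j))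
    (hS : Pairwise (Function.onFun Disjoint S)) {u : Fin N → (Fin n → ℝ) → ℝ}
    (hu : ∀ j, IsTestFun (D ∩ S j) (u j)) (hpos : ∀ j, 0 < ∫ x, |u j x| ^ P.toReal)
    (hle : ∀ j, ∑ i, ∫ x, |pder i (u j) x| ^ P.toReal ≤
      (r ^ (-P.toReal) - 1) * ∫ x, |u j x| ^ P.toReal) :
    FactorsIdentity P (SobolevEmb P D) r N := by
  have h0 := ENNReal.toReal_pos (zero_lt_one.trans_le hP1.out).ne' hP
  have huD : ∀ j, IsTestFun D (u j) := fun j => (hu j).mono inter_subset_left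
  let w : Fin N → W0sub P D := fun j => ⟨(huD j).memLp_jet.toLp, subset_closure
    (Submodule.subset_span ⟨u j, huD j, (huD j).memLp_jet.coeFn_toLp⟩)⟩
  have hwj : ∀ j, (w j : Vsp n P) =ᵐ[volume] jet P (u j) := fun j => (huD j).memLp_jet.coeFn_toLp
  have hTw : ∀ j, SobolevEmb P D (w j) = (proj0 n P).compLpL P volume (w j : Vsp n P) :=
    fun j => rfl
  have hTn : ∀ j, ‖SobolevEmb P D (w j)‖ ^ P.toReal = ∫ x, |u j x| ^ P.toReal := fun j => by
    rw [hTw, norm_compLpL_proj0_rpow hP (hwj j)]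
  have hzero : ∀ j, ∀ x ∉ S j, u j =ᶠ[𝓝 x] 0 := fun j x hx =>
    (hu j).eventuallyEq_zero fun h => hx h.2
  refine factorsIdentity_of_disjoint hP _ hr hSm hS w (fun j => ?_) (fun j => ?_) (fun j => ?_)
    fun j => ?_
  · filter_upwards [hwj j] with x hx hxS
    rw [hx, jet_eq_zero (hzero j x hxS)]
  · rw [hTw]
    filter_upwards [compLpL_proj0_ae_eq (hwj j)] with x hx hxS
    rw [hx, (hzero j x hxS).self_of_nhds]
    rfl
  · refine norm_pos_iff.2 fun h => (hpos j).ne' ?_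
    rw [← hTn, h, map_zero, norm_zero, Real.zero_rpow h0.ne']
  · rw [← Real.rpow_le_rpow_iff (by positivity) (norm_nonneg _) h0, hTn,
      Real.mul_rpow hr.le (norm_nonneg _), Submodule.coe_norm, norm_rpow_of_ae_eq_jet hP (huD j) (hwj j)]
    have h1 : 0 < r ^ P.toReal := by positivity
    have h2 := hle j
    rw [Real.rpow_neg hr.le] at h2
    have h3 := mul_le_mul_of_nonneg_left h2 h1.le
    rw [← mul_assoc, mul_sub, mul_inv_cancel₀ h1.ne'] at h3
    linarith

theorem poincare_stripDomain {p q : ℝ} (hpq : p.HolderConjugate q) {k : ℕ} {a b : Fin n → ℝ}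
    (hab : ∀ i : Fin n, k ≤ (i : ℕ) → a i < b i) (hu : IsTestFun (stripDomain n k a b) u) :
    (∑ i ∈ Finset.univ.filter (fun i : Fin n => k ≤ (i : ℕ)),
      (p - 1) * (piP p / (b i - a i)) ^ p) * ∫ x, |u x| ^ p ≤ ∑ i, ∫ x, |pder i u x| ^ p := by
  rw [Finset.sum_mul]
  refine (Finset.sum_le_sum fun i hi => ?_).trans (Finset.sum_le_sum_of_subset_of_nonneg
    (Finset.subset_univ _) fun i _ _ => integral_nonneg fun x => by positivity)
  have hi' := (Finset.mem_filter.1 hi).2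
  exact poincare_slab hpq i (hab i hi') (D := stripDomain n k a b) (fun x hx => hx i hi') hu

theorem factorsIdentity_stripDomain {p q : ℝ} [Fact (1 ≤ ENNReal.ofReal p)]
    (hpq : p.HolderConjugate q) {k : ℕ} {a b : Fin n → ℝ}
    (hab : ∀ i : Fin n, k ≤ (i : ℕ) → a i < b i) (i₀ : Fin n) (hi₀ : (i₀ : ℕ) < k) {r : ℝ}
    (hr : 0 < r)
    (hr' : r < (1 + ∑ i ∈ Finset.univ.filter (fun i : Fin n => k ≤ (i : ℕ)),
      (p - 1) * (piP p / (b i - a i)) ^ p) ^ (-1 / p)) (N : ℕ) :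
    FactorsIdentity (ENNReal.ofReal p) (SobolevEmb (ENNReal.ofReal p) (stripDomain n k a b)) r N := by
  have hpr : (ENNReal.ofReal p).toReal = p := ENNReal.toReal_ofReal hpq.nonneg
  have hΛ : 0 ≤ ∑ i ∈ Finset.univ.filter (fun i : Fin n => k ≤ (i : ℕ)),
      (p - 1) * (piP p / (b i - a i)) ^ p := Finset.sum_nonneg fun i hi =>
    mul_nonneg hpq.sub_one_pos.le (Real.rpow_nonneg (div_nonneg (piP_pos hpq).le
      (sub_pos.2 (hab i (Finset.mem_filter.1 hi).2)).le) _)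
  have hε : 0 < r ^ (-p) - 1 - ∑ i ∈ Finset.univ.filter (fun i : Fin n => k ≤ (i : ℕ)),
      (p - 1) * (piP p / (b i - a i)) ^ p := by
    have h1 := Real.rpow_lt_rpow_of_neg hr hr' (neg_lt_zero.2 hpq.pos)
    rw [← Real.rpow_mul (by positivity), neg_div, neg_mul_neg, one_div,
      inv_mul_cancel₀ hpq.pos.ne', Real.rpow_one] at h1
    linarith
  obtain ⟨R, hR, hu⟩ := exists_isTestFun_family hpq hab i₀ hi₀ hε
  choose u hu hpos hle using hu
  refine factorsIdentity_sobolevEmb ENNReal.ofReal_ne_top hr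
    (S := fun j : Fin N => {x | x i₀ ∈ Ioo ((j : ℕ) * R) (((j : ℕ) + 1) * R)})
    (u := fun j => u j) (fun j => measurableSet_Ioo.preimage (measurable_pi_apply i₀)) ?_
    (fun j => hu j) (fun j => ?_) fun j => ?_
  · have hlt : ∀ i j : Fin N, i < j → ∀ x : Fin n → ℝ, x i₀ < ((i : ℕ) + 1) * R →
        ((j : ℕ) : ℝ) * R < x i₀ → False := by
      intro i j hij x h1 h2
      have h3 : ((i : ℕ) : ℝ) + 1 ≤ (j : ℕ) := by exact_mod_cast hij
      have := mul_le_mul_of_nonneg_right h3 hR.le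
      linarith
    refine fun i j hij => Set.disjoint_left.2 fun x hxi hxj => ?_
    rcases lt_or_gt_of_ne hij with h | h
    · exact hlt i j h x hxi.2 hxj.1
    · exact hlt j i h x hxj.2 hxi.1
  · rw [hpr]
    exact hpos j
  · rw [hpr]
    refine (hle j).trans (le_of_eq ?_)
    ring

end Sobolev

/-- For the canonical embedding `I : W₀^{1,p}(D) ↪ L^p(D)` on the
strip-like domain `D = ℝᵏ × ∏_{i=1}^{n-k} (aᵢ,bᵢ)`, the approximation, Bernstein, Gelfand,
Kolmogorov, isomorphism, Mityagin and entropy numbers all coincide with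
`‖I‖ = (1 + π_p^p (p-1) ∑ (bᵢ-aᵢ)^{-p})^{-1/p}`, for every `m`. -/
theorem sNumbers_sobolevEmbedding_stripDomain
    (n k : ℕ) (hn : 2 ≤ n) (hk1 : 1 ≤ k) (hk : k < n) (p : ℝ) (hp : 1 < p)
    (a b : Fin n → ℝ) (hab : ∀ i : Fin n, k ≤ (i : ℕ) → a i < b i)
    (m : ℕ) (hm : 1 ≤ m) :
    letI : Fact (1 ≤ ENNReal.ofReal p) := ⟨ENNReal.one_le_ofReal.mpr hp.le⟩
    approxNumber m (SobolevEmb (ENNReal.ofReal p) (stripDomain n k a b)) =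
        (1 + piP p ^ p * (p - 1) *
          ∑ i ∈ Finset.univ.filter (fun i : Fin n => k ≤ (i : ℕ)),
            (b i - a i) ^ (-p)) ^ (-1 / p) ∧
      bernsteinNumber m (SobolevEmb (ENNReal.ofReal p) (stripDomain n k a b)) =
        (1 + piP p ^ p * (p - 1) *
          ∑ i ∈ Finset.univ.filter (fun i : Fin n => k ≤ (i : ℕ)),
            (b i - a i) ^ (-p)) ^ (-1 / p) ∧
      gelfandNumber m (SobolevEmb (ENNReal.ofReal p) (stripDomain n k a b)) =
        (1 + piP p ^ p * (p - 1) *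
          ∑ i ∈ Finset.univ.filter (fun i : Fin n => k ≤ (i : ℕ)),
            (b i - a i) ^ (-p)) ^ (-1 / p) ∧
      kolmogorovNumber m (SobolevEmb (ENNReal.ofReal p) (stripDomain n k a b)) =
        (1 + piP p ^ p * (p - 1) *
          ∑ i ∈ Finset.univ.filter (fun i : Fin n => k ≤ (i : ℕ)),
            (b i - a i) ^ (-p)) ^ (-1 / p) ∧
      isoNumber m (SobolevEmb (ENNReal.ofReal p) (stripDomain n k a b)) =
        (1 + piP p ^ p * (p - 1) *
          ∑ i ∈ Finset.univ.filter (fun i : Fin n => k ≤ (i : ℕ)),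
            (b i - a i) ^ (-p)) ^ (-1 / p) ∧
      mityaginNumber m (SobolevEmb (ENNReal.ofReal p) (stripDomain n k a b)) =
        (1 + piP p ^ p * (p - 1) *
          ∑ i ∈ Finset.univ.filter (fun i : Fin n => k ≤ (i : ℕ)),
            (b i - a i) ^ (-p)) ^ (-1 / p) ∧
      entropyNumber m (SobolevEmb (ENNReal.ofReal p) (stripDomain n k a b)) =
        (1 + piP p ^ p * (p - 1) *
          ∑ i ∈ Finset.univ.filter (fun i : Fin n => k ≤ (i : ℕ)),
            (b i - a i) ^ (-p)) ^ (-1 / p) ∧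
      ‖SobolevEmb (ENNReal.ofReal p) (stripDomain n k a b)‖ =
        (1 + piP p ^ p * (p - 1) *
          ∑ i ∈ Finset.univ.filter (fun i : Fin n => k ≤ (i : ℕ)),
            (b i - a i) ^ (-p)) ^ (-1 / p) := by
  have hpq := Real.HolderConjugate.conjExponent hp
  have : Fact (1 ≤ ENNReal.ofReal p) := ⟨ENNReal.one_le_ofReal.mpr hp.le⟩
  have hpr : (ENNReal.ofReal p).toReal = p := ENNReal.toReal_ofReal hpq.nonneg
  have hΛ : piP p ^ p * (p - 1) * ∑ i ∈ Finset.univ.filter (fun i : Fin n => k ≤ (i : ℕ)),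
      (b i - a i) ^ (-p) = ∑ i ∈ Finset.univ.filter (fun i : Fin n => k ≤ (i : ℕ)),
        (p - 1) * (piP p / (b i - a i)) ^ p := by
    rw [Finset.mul_sum]
    refine Finset.sum_congr rfl fun i hi => ?_
    have hpos := sub_pos.2 (hab i (Finset.mem_filter.1 hi).2)
    rw [Real.div_rpow (piP_pos hpq).le hpos.le, Real.rpow_neg hpos.le]
    ring
  have hΛ0 : 0 ≤ ∑ i ∈ Finset.univ.filter (fun i : Fin n => k ≤ (i : ℕ)),
      (p - 1) * (piP p / (b i - a i)) ^ p := Finset.sum_nonneg fun i hi =>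
    mul_nonneg hpq.sub_one_pos.le (Real.rpow_nonneg (div_nonneg (piP_pos hpq).le
      (sub_pos.2 (hab i (Finset.mem_filter.1 hi).2)).le) _)
  rw [hΛ]
  refine sNumbers_eq_of_factorsIdentity (q := ENNReal.ofReal p) (by positivity) ?_
    (fun r hr hr' N => factorsIdentity_stripDomain hpq hab ⟨0, by omega⟩ hk1 hr hr' N) hm
  have h := norm_sobolevEmb_le (D := stripDomain n k a b) (P := ENNReal.ofReal p)
    ENNReal.ofReal_ne_top hΛ0 fun u hu => by rw [hpr]; exact poincare_stripDomain hpq hab hu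
  rwa [hpr] at h
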